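/- arXiv:1808.04180 — 6 statements merged into one kernel-verified Lean document; each statement's English description precedes it below -/
import Mathlib

section
/- Let C be a cone in a real vector space V, Γ a cone in a real vector space W, and f : V → W a linear map with f(C) ⊆ Γ. Let κ(f; C, Γ) = inf{λ ≥ 0 : d_Γ(f(x), f(y)) ≤ λ·d_C(x, y) for all x, y ∈ C with x ∼_C y and f(x) ∼_Γ f(y)} be the smallest Lipschitz constant of f : (C, d_C) → (Γ, d_Γ). Then κ(f; C, Γ) = tanh(¼ · diam(f(C); Γ)), with the convention tanh(∞) = 1. -/
/-- `x ⪯_C y` iff `y - x ∈ C`. -/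
def coneLE {V : Type*} [AddCommGroup V] [Module ℝ V] (C : Set V) (x y : V) : Prop :=
  y - x ∈ C

/-- A (convex, pointed) cone in a real vector space. -/
def IsCone {V : Type*} [AddCommGroup V] [Module ℝ V] (C : Set V) : Prop :=
  Convex ℝ C ∧ (∀ x ∈ C, ∀ a : ℝ, 0 ≤ a → a • x ∈ C) ∧ C ∩ (-C) = {0}

/-- `x ∼_C y` : there are `α, β > 0` with `α • y ⪯_C x ⪯_C β • y`. -/
def coneComp {V : Type*} [AddCommGroup V] [Module ℝ V] (C : Set V) (x y : V) : Prop :=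
  (∃ α : ℝ, 0 < α ∧ coneLE C (α • y) x) ∧ (∃ β : ℝ, 0 < β ∧ coneLE C x (β • y))

/-- `M(x/y; C) = inf {β : x ⪯_C β • y}`. -/
noncomputable def coneM {V : Type*} [AddCommGroup V] [Module ℝ V] (C : Set V) (x y : V) : ℝ :=
  sInf {β : ℝ | coneLE C x (β • y)}

/-- The Hilbert projective metric `d_C(x,y) = log (M(x/y;C) * M(y/x;C))`. -/
noncomputable def hilbertD {V : Type*} [AddCommGroup V] [Module ℝ V] (C : Set V) (x y : V) : ℝ :=
  Real.log (coneM C x y * coneM C y x)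

/-- The projective diameter `diam(S; C)` (possibly `+∞`). -/
noncomputable def projDiam {V : Type*} [AddCommGroup V] [Module ℝ V] (C S : Set V) : EReal :=
  sSup {r : EReal | ∃ x ∈ S, ∃ y ∈ S, coneComp C x y ∧ r = ((hilbertD C x y : ℝ) : EReal)}

/-- `tanh (t/4)` with the convention `tanh ∞ = 1`. -/
noncomputable def tanh4 (t : EReal) : ℝ :=
  if t = ⊤ then 1 else Real.tanh (t.toReal / 4)

section aux

variable {V : Type*} [AddCommGroup V] [Module ℝ V] {C : Set V}

lemma IsCone.zero_mem' (hC : IsCone C) : (0 : V) ∈ C := by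
  have h : (0 : V) ∈ C ∩ (-C) := by rw [hC.2.2]; rfl
  exact h.1

lemma IsCone.smul_mem' (hC : IsCone C) {x : V} (hx : x ∈ C) {a : ℝ} (ha : 0 ≤ a) : a • x ∈ C :=
  hC.2.1 x hx a ha

lemma IsCone.add_mem' (hC : IsCone C) {x y : V} (hx : x ∈ C) (hy : y ∈ C) : x + y ∈ C := by
  have h : (1 / 2 : ℝ) • x + (1 / 2 : ℝ) • y ∈ C :=
    convex_iff_forall_pos.1 hC.1 hx hy (by norm_num) (by norm_num) (by norm_num)
  have h2 := hC.smul_mem' h (a := 2) (by norm_num)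
  rw [← smul_add, smul_smul] at h2
  norm_num at h2
  exact h2

lemma IsCone.eq_zero' (hC : IsCone C) {x : V} (hx : x ∈ C) (hx' : -x ∈ C) : x = 0 := by
  have h : x ∈ C ∩ (-C) := ⟨hx, by simpa using hx'⟩
  rw [hC.2.2] at h
  exact h

/-- coefficient comparison -/
lemma cone_coeff_le (hC : IsCone C) {x y : V} (hy : y ∈ C) (hy0 : y ≠ 0) {t s : ℝ}
    (h1 : coneLE C (t • y) x) (h2 : coneLE C x (s • y)) : t ≤ s := by
  by_contra! h
  unfold coneLE at h1 h2
  have h3 := hC.add_mem' h1 h2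
  have h4 : (x - t • y) + (s • y - x) = -((t - s) • y) := by module
  rw [h4] at h3
  have h5 := hC.eq_zero' (hC.smul_mem' hy (sub_pos.2 h).le) h3
  rcases smul_eq_zero.1 h5 with h6 | h6
  · linarith
  · exact hy0 h6

lemma coneLE_inv (hC : IsCone C) {x y : V} {t : ℝ} (ht : 0 < t)
    (h : coneLE C (t • y) x) : coneLE C y (t⁻¹ • x) := by
  unfold coneLE at *
  have := hC.smul_mem' h (inv_pos.2 ht).le
  rwa [smul_sub, smul_smul, inv_mul_cancel₀ ht.ne', one_smul] at this

lemma coneComp_symm (hC : IsCone C) {x y : V} (h : coneComp C x y) : coneComp C y x := by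
  obtain ⟨⟨a, ha, h1⟩, ⟨b, hb, h2⟩⟩ := h
  refine ⟨⟨b⁻¹, inv_pos.2 hb, ?_⟩, ⟨a⁻¹, inv_pos.2 ha, coneLE_inv hC ha h1⟩⟩
  unfold coneLE at *
  have := hC.smul_mem' h2 (inv_pos.2 hb).le
  rwa [smul_sub, smul_smul, inv_mul_cancel₀ hb.ne', one_smul] at this

lemma coneComp_zero (hC : IsCone C) {x : V} (hx : x ∈ C) (h : coneComp C x 0) : x = 0 := by
  obtain ⟨-, ⟨b, hb, h2⟩⟩ := h
  unfold coneLE at h2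
  exact hC.eq_zero' hx (by simpa using h2)

lemma coneComp_ne (hC : IsCone C) {x y : V} (hy : y ∈ C) (h : coneComp C x y)
    (hx : x ≠ 0) : y ≠ 0 ∧ True := by
  refine ⟨?_, trivial⟩
  rintro rfl
  obtain ⟨⟨a, ha, h1⟩, ⟨b, hb, h2⟩⟩ := h
  unfold coneLE at h1 h2
  exact hx (hC.eq_zero' (by simpa using h1) (by simpa using h2))

lemma coneM_bdd (hC : IsCone C) {x y : V} (hy : y ∈ C) (hy0 : y ≠ 0) (h : coneComp C x y) :
    BddBelow {β : ℝ | coneLE C x (β • y)} := by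
  obtain ⟨⟨a, ha, h1⟩, -⟩ := h
  exact ⟨a, fun b hb => cone_coeff_le hC hy hy0 h1 hb⟩

lemma coneM_le (hC : IsCone C) {x y : V} (hy : y ∈ C) (hy0 : y ≠ 0) (h : coneComp C x y)
    {b : ℝ} (hb : coneLE C x (b • y)) : coneM C x y ≤ b :=
  csInf_le (coneM_bdd hC hy hy0 h) hb

lemma coneM_pos (hC : IsCone C) {x y : V} (hy : y ∈ C) (hy0 : y ≠ 0) (h : coneComp C x y) :
    0 < coneM C x y := by
  obtain ⟨⟨a, ha, h1⟩, ⟨b, hb, h2⟩⟩ := h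
  exact ha.trans_le (le_csInf ⟨b, h2⟩ fun b hb => cone_coeff_le hC hy hy0 h1 hb)

lemma coneLE_of_lt (hC : IsCone C) {x y : V} (hy : y ∈ C) (h : coneComp C x y)
    {b : ℝ} (hb : coneM C x y < b) : coneLE C x (b • y) := by
  obtain ⟨-, ⟨b0, hb0, h2⟩⟩ := h
  obtain ⟨c, hc, hcb⟩ := exists_lt_of_csInf_lt ⟨b0, h2⟩ hb
  have h3 : coneLE C x (c • y) := hc
  unfold coneLE at *
  have := hC.add_mem' h3 (hC.smul_mem' hy (sub_pos.2 hcb).le)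
  have e : c • y - x + (b - c) • y = b • y - x := by module
  rwa [e] at this

lemma hilbertD_zero : hilbertD C (0 : V) 0 = 0 := by
  unfold hilbertD coneM coneLE
  by_cases h : (0 : V) ∈ C <;> simp [h]

lemma hilbertD_le (hC : IsCone C) {x y : V} (hx : x ∈ C) (hy : y ∈ C) (hx0 : x ≠ 0) (hy0 : y ≠ 0)
    {t s : ℝ} (ht : 0 < t) (hs : 0 < s)
    (h1 : coneLE C (t • y) x) (h2 : coneLE C x (s • y)) :
    hilbertD C x y ≤ Real.log (s / t) := by
  have hc : coneComp C x y := ⟨⟨t, ht, h1⟩, ⟨s, hs, h2⟩⟩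
  have hc' := coneComp_symm hC hc
  have p1 := coneM_pos hC hy hy0 hc
  have p2 := coneM_pos hC hx hx0 hc'
  have l1 := coneM_le hC hy hy0 hc h2
  have l2 := coneM_le hC hx hx0 hc' (coneLE_inv hC ht h1)
  unfold hilbertD
  apply Real.log_le_log (by positivity)
  rw [div_eq_mul_inv]
  gcongr

lemma hilbertD_approx (hC : IsCone C) {x y : V} (hx : x ∈ C) (hy : y ∈ C) (hx0 : x ≠ 0)
    (hy0 : y ≠ 0) (hc : coneComp C x y) {e : ℝ} (he : 0 < e) :
    ∃ t s : ℝ, 0 < t ∧ 0 < s ∧ coneLE C (t • y) x ∧ coneLE C x (s • y) ∧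
      Real.log (s / t) = hilbertD C x y + 2 * e := by
  have hc' := coneComp_symm hC hc
  have p1 := coneM_pos hC hy hy0 hc
  have p2 := coneM_pos hC hx hx0 hc'
  have e1 : 1 < Real.exp e := Real.one_lt_exp_iff.2 he
  have e0 := Real.exp_pos e
  have h1 : coneLE C x ((coneM C x y * Real.exp e) • y) :=
    coneLE_of_lt hC hy hc (by nlinarith)
  have h2 : coneLE C y ((coneM C y x * Real.exp e) • x) :=
    coneLE_of_lt hC hx hc' (by nlinarith)
  refine ⟨(coneM C y x * Real.exp e)⁻¹, coneM C x y * Real.exp e, by positivity, by positivity,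
    ?_, h1, ?_⟩
  · have hq : 0 < coneM C y x * Real.exp e := by positivity
    unfold coneLE at *
    have := hC.smul_mem' h2 (inv_pos.2 hq).le
    rwa [smul_sub, smul_smul, inv_mul_cancel₀ hq.ne', one_smul] at this
  · unfold hilbertD
    rw [div_inv_eq_mul, Real.log_mul (by positivity) (by positivity),
      Real.log_mul (by positivity) (by positivity), Real.log_mul (by positivity) (by positivity),
      Real.log_mul (by positivity) (by positivity), Real.log_exp]
    ring

lemma le_hilbertD (hC : IsCone C) {x y : V} (hx : x ∈ C) (hy : y ∈ C) (hx0 : x ≠ 0)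
    (hy0 : y ≠ 0) (hc : coneComp C x y) {c : ℝ}
    (h : ∀ t s : ℝ, 0 < t → 0 < s → coneLE C (t • y) x → coneLE C x (s • y) →
      c ≤ Real.log (s / t)) : c ≤ hilbertD C x y := by
  apply le_of_forall_pos_le_add
  intro e he
  obtain ⟨t, s, ht, hs, h1, h2, h3⟩ := hilbertD_approx hC hx hy hx0 hy0 hc (half_pos he)
  have := h t s ht hs h1 h2
  linarith

lemma hilbertD_nonneg (hC : IsCone C) {x y : V} (hx : x ∈ C) (hy : y ∈ C)
    (hc : coneComp C x y) : 0 ≤ hilbertD C x y := by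
  by_cases hy0 : y = 0
  · subst hy0
    rw [coneComp_zero hC hx hc, hilbertD_zero]
  by_cases hx0 : x = 0
  · subst hx0
    exact absurd (coneComp_zero hC hy (coneComp_symm hC hc)) hy0
  apply le_hilbertD hC hx hy hx0 hy0 hc
  intro t s ht hs h1 h2
  apply Real.log_nonneg
  rw [one_le_div ht]
  exact cone_coeff_le hC hy hy0 h1 h2

end aux

lemma tanh_quarter_log (R : ℝ) (hR : 0 < R) :
    Real.tanh (Real.log R / 4) = (Real.sqrt R - 1) / (Real.sqrt R + 1) := by
  have hs : 0 < Real.sqrt R := Real.sqrt_pos.2 hR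
  set z := Real.log R / 4 with hz
  have h1 : Real.sqrt R = Real.exp z * Real.exp z := by
    rw [← Real.exp_add, hz, Real.sqrt_eq_rpow, Real.rpow_def_of_pos hR]
    congr 1; ring
  rw [h1, Real.tanh_eq_sinh_div_cosh, Real.sinh_eq, Real.cosh_eq, Real.exp_neg]
  have := Real.exp_pos z
  field_simp

lemma tanh_mono {a b : ℝ} (h : a ≤ b) : Real.tanh a ≤ Real.tanh b := by
  rw [Real.tanh_eq_sinh_div_cosh, Real.tanh_eq_sinh_div_cosh,
    div_le_div_iff₀ (Real.cosh_pos a) (Real.cosh_pos b)]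
  have h1 := Real.sinh_nonneg_iff.2 (sub_nonneg.2 h)
  rw [Real.sinh_sub] at h1
  linarith

lemma tanh_cont : Continuous Real.tanh := by
  have : Real.tanh = fun x => Real.sinh x / Real.cosh x :=
    funext Real.tanh_eq_sinh_div_cosh
  rw [this]
  exact Real.continuous_sinh.div Real.continuous_cosh fun x => (Real.cosh_pos x).ne'

/-- derivative of the scalar function -/
lemma scal_deriv (l p q x : ℝ) (hp : 0 < p) (hq : 0 < q) (hx : 0 < x) :
    HasDerivAt (fun r => l * Real.log r - (Real.log (1 + q * r) - Real.log (1 + p * r)))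
      (l * x⁻¹ - (q / (1 + q * x) - p / (1 + p * x))) x := by
  have h1 : HasDerivAt (fun r => 1 + q * r) q x := by
    simpa using ((hasDerivAt_id x).const_mul q).const_add 1
  have h2 : HasDerivAt (fun r => 1 + p * r) p x := by
    simpa using ((hasDerivAt_id x).const_mul p).const_add 1
  exact ((Real.hasDerivAt_log hx.ne').const_mul l).sub
    ((h1.log (by positivity)).sub (h2.log (by positivity)))

lemma scal_ineq (p q r : ℝ) (hp : 0 < p) (hpq : p ≤ q) (hr : 1 ≤ r) :
    Real.log (1 + q * r) - Real.log (1 + p * r) - (Real.log (1 + q) - Real.log (1 + p)) ≤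
      Real.tanh (Real.log (q / p) / 4) * Real.log r := by
  have hq : 0 < q := hp.trans_le hpq
  set k := Real.tanh (Real.log (q / p) / 4) with hk
  have key : MonotoneOn
      (fun r => k * Real.log r - (Real.log (1 + q * r) - Real.log (1 + p * r))) (Set.Ici 1) := by
    apply monotoneOn_of_deriv_nonneg (convex_Ici 1)
    · intro x hx
      have hx : (1 : ℝ) ≤ x := hx
      exact (scal_deriv k p q x hp hq (by linarith)).continuousAt.continuousWithinAt
    · intro x hx
      rw [interior_Ici] at hx
      have hx : (1 : ℝ) < x := hx
      exact (scal_deriv k p q x hp hq (by linarith)).differentiableAt.differentiableWithinAt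
    · intro x hx
      rw [interior_Ici] at hx
      have hx : (1 : ℝ) < x := hx
      have hx0 : 0 < x := by linarith
      rw [(scal_deriv k p q x hp hq hx0).deriv]
      have hk' : k = (q - p) / (Real.sqrt q + Real.sqrt p) ^ 2 := by
        rw [hk, tanh_quarter_log _ (by positivity), Real.sqrt_div hq.le]
        have a1 := Real.sqrt_pos.2 hp
        have a2 := Real.sqrt_pos.2 hq
        have b1 : Real.sqrt p ^ 2 = p := Real.sq_sqrt hp.le
        have b2 : Real.sqrt q ^ 2 = q := Real.sq_sqrt hq.le
        nth_rewrite 3 [← b1]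
        nth_rewrite 3 [← b2]
        field_simp
        ring
      have e : q / (1 + q * x) - p / (1 + p * x) = (q - p) / ((1 + q * x) * (1 + p * x)) := by
        field_simp
        ring
      rw [e, hk', sub_nonneg, ← div_eq_mul_inv, div_div]
      have a1 := Real.sqrt_pos.2 hp
      have a2 := Real.sqrt_pos.2 hq
      have b1 : Real.sqrt p ^ 2 = p := Real.sq_sqrt hp.le
      have b2 : Real.sqrt q ^ 2 = q := Real.sq_sqrt hq.le
      apply div_le_div_of_nonneg_left (by linarith) (by positivity)
      generalize Real.sqrt p = u at *
      generalize Real.sqrt q = v at *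
      subst b1 b2
      nlinarith [sq_nonneg (u * v * x - 1)]
  have := key (Set.mem_Ici.2 le_rfl) (Set.mem_Ici.2 hr) hr
  simp only [Real.log_one, mul_zero, mul_one] at this
  linarith

lemma scal_lower (l h : ℝ) 
    (H : ∀ b : ℝ, 1 < b → Real.log (1 + Real.exp h * b) - Real.log (1 + Real.exp (-h) * b) -
      (Real.log (1 + Real.exp h) - Real.log (1 + Real.exp (-h))) ≤ l * Real.log b) :
    Real.tanh (h / 2) ≤ l := by
  have hd := scal_deriv l (Real.exp (-h)) (Real.exp h) 1 (Real.exp_pos _) (Real.exp_pos _) one_pos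
  have hs := (hasDerivAt_iff_tendsto_slope.1 hd).mono_left
    (nhdsWithin_mono (s := Set.Ioi (1 : ℝ)) 1 (fun x hx => ne_of_gt hx))
  have h0 := ge_of_tendsto (b := 0) hs (by
    filter_upwards [self_mem_nhdsWithin] with b hb
    have hb : (1 : ℝ) < b := hb
    have := H b hb
    rw [slope_def_field]
    apply div_nonneg _ (by linarith)
    simp only [Real.log_one, mul_zero, mul_one]
    linarith)
  have e : Real.tanh (h / 2) = Real.exp h / (1 + Real.exp h * 1) -
      Real.exp (-h) / (1 + Real.exp (-h) * 1) := by
    have h1 : Real.exp h = Real.exp (h / 2) * Real.exp (h / 2) := by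
      rw [← Real.exp_add]; congr 1; ring
    rw [Real.exp_neg, h1, Real.tanh_eq_sinh_div_cosh, Real.sinh_eq, Real.cosh_eq, Real.exp_neg]
    have := Real.exp_pos (h / 2)
    generalize Real.exp (h / 2) = z at *
    field_simp
    ring
  rw [e]
  simp only [inv_one, mul_one] at h0 ⊢
  linarith

section main

variable {V W : Type*} [AddCommGroup V] [Module ℝ V] [AddCommGroup W] [Module ℝ W]
  {C : Set V} {Γ : Set W} {f : V →ₗ[ℝ] W}

lemma map_coneLE (hf : f '' C ⊆ Γ) {x y : V} {s t : ℝ} (h : coneLE C (s • x) (t • y)) :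
    coneLE Γ (s • f x) (t • f y) := by
  unfold coneLE at *
  have := hf ⟨_, h, rfl⟩
  simpa using this

lemma map_coneComp (hf : f '' C ⊆ Γ) {x y : V} (h : coneComp C x y) :
    coneComp Γ (f x) (f y) := by
  obtain ⟨⟨a, ha, h1⟩, ⟨b, hb, h2⟩⟩ := h
  refine ⟨⟨a, ha, ?_⟩, ⟨b, hb, ?_⟩⟩
  · have := map_coneLE (s := a) (t := 1) (x := y) (y := x) hf (by simpa using h1)
    simpa using this
  · have := map_coneLE (s := 1) (t := b) (x := x) (y := y) hf (by simpa using h2)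
    simpa using this

lemma map_ne {x : V} (h : f x ≠ 0) : x ≠ 0 := by
  rintro rfl
  simp at h

/-- nonexpansiveness -/
lemma nonexp (hC : IsCone C) (hΓ : IsCone Γ) (hf : f '' C ⊆ Γ) {x y : V} (hx : x ∈ C) (hy : y ∈ C)
    (hc : coneComp C x y) : hilbertD Γ (f x) (f y) ≤ hilbertD C x y := by
  have hc' := map_coneComp hf hc
  have hfx : f x ∈ Γ := hf ⟨_, hx, rfl⟩
  have hfy : f y ∈ Γ := hf ⟨_, hy, rfl⟩
  by_cases hy0 : f y = 0
  · rw [hy0] at hc' ⊢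
    rw [coneComp_zero hΓ hfx hc', hilbertD_zero]
    exact hilbertD_nonneg hC hx hy hc
  have hx0 : f x ≠ 0 := by
    intro h
    rw [h] at hc'
    exact hy0 (coneComp_zero hΓ hfy (coneComp_symm hΓ hc'))
  apply le_hilbertD hC hx hy (map_ne hx0) (map_ne hy0) hc
  intro t s ht hs h1 h2
  apply hilbertD_le hΓ hfx hfy hx0 hy0 ht hs
  · have := map_coneLE (s := t) (t := 1) (x := y) (y := x) hf (by simpa using h1)
    simpa using this
  · have := map_coneLE (s := 1) (t := s) (x := x) (y := y) hf (by simpa using h2)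
    simpa using this

/-- the contraction estimate -/
lemma contr (hC : IsCone C) (hΓ : IsCone Γ) (hf : f '' C ⊆ Γ) {Δ : ℝ}
    (hΔ : ∀ u ∈ C, ∀ v ∈ C, coneComp Γ (f u) (f v) → hilbertD Γ (f u) (f v) ≤ Δ)
    (hΔ0 : 0 ≤ Δ)
    {x y : V} (hx : x ∈ C) (hy : y ∈ C)
    (hc : coneComp C x y) : hilbertD Γ (f x) (f y) ≤ Real.tanh (Δ / 4) * hilbertD C x y := by
  have hc' := map_coneComp hf hc
  have hfx : f x ∈ Γ := hf ⟨_, hx, rfl⟩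
  have hfy : f y ∈ Γ := hf ⟨_, hy, rfl⟩
  have hT : 0 ≤ Real.tanh (Δ / 4) := by
    have := tanh_mono (show 0 ≤ Δ / 4 by positivity)
    simpa using this
  by_cases hy0 : f y = 0
  · rw [hy0] at hc' ⊢
    rw [coneComp_zero hΓ hfx hc', hilbertD_zero]
    exact mul_nonneg hT (hilbertD_nonneg hC hx hy hc)
  have hx0 : f x ≠ 0 := by
    intro h
    rw [h] at hc'
    exact hy0 (coneComp_zero hΓ hfy (coneComp_symm hΓ hc'))
  have hdn := hilbertD_nonneg hC hx hy hc
  have main : ∀ e : ℝ, 0 < e →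
      hilbertD Γ (f x) (f y) ≤ Real.tanh ((Δ + 2 * e) / 4) * (hilbertD C x y + 4 * e) := by
    intro e he
    obtain ⟨t, s, ht, hs, h1, h2, h3⟩ :=
      hilbertD_approx hC hx hy (map_ne hx0) (map_ne hy0) hc he
    have hts : t ≤ s := cone_coeff_le hC hy (map_ne hy0) h1 h2
    have e1 : 1 < Real.exp e := Real.one_lt_exp_iff.2 he
    -- widen
    obtain ⟨a, ha⟩ : ∃ a, a = t * Real.exp (-e) := ⟨_, rfl⟩
    obtain ⟨b, hb⟩ : ∃ b, b = s * Real.exp e := ⟨_, rfl⟩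
    have ha0 : 0 < a := by rw [ha]; positivity
    have hat : a < t := by
      have : Real.exp (-e) < 1 := by rw [Real.exp_lt_one_iff]; linarith
      rw [ha]; nlinarith
    have hbs : s < b := by rw [hb]; nlinarith
    have hab : a < b := by linarith
    have hb0 : 0 < b := by linarith
    have hlog : Real.log (b / a) = hilbertD C x y + 4 * e := by
      have e2 : Real.log (b / a) = Real.log (s / t) + 2 * e := by
        rw [ha, hb, Real.log_div (by positivity) (by positivity),
          Real.log_mul (by positivity) (by positivity),
          Real.log_mul (by positivity) (by positivity),
          Real.log_div (by positivity) (by positivity), Real.log_exp, Real.log_exp]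
        ring
      rw [e2, h3]; ring
    obtain ⟨u, hu⟩ : ∃ u, u = x - a • y := ⟨_, rfl⟩
    obtain ⟨v, hv⟩ : ∃ v, v = b • y - x := ⟨_, rfl⟩
    unfold coneLE at h1 h2
    have huC : u ∈ C := by
      have := hC.add_mem' h1 (hC.smul_mem' hy (sub_pos.2 hat).le)
      convert this using 1
      rw [hu]; module
    have hvC : v ∈ C := by
      have := hC.add_mem' h2 (hC.smul_mem' hy (sub_pos.2 hbs).le)
      convert this using 1
      rw [hv]; module
    have huv : coneComp C u v := by
      refine ⟨⟨(t - a) / (b - t), div_pos (by linarith) (by linarith), ?_⟩,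
        ⟨(s - a) / (b - s), div_pos (by linarith) (by linarith), ?_⟩⟩
      · unfold coneLE
        have := hC.smul_mem' h1 (a := (b - a) / (b - t))
          (div_nonneg (by linarith) (by linarith))
        convert this using 1
        rw [hu, hv]
        have : b - t ≠ 0 := by linarith
        match_scalars <;> field_simp <;> ring
      · unfold coneLE
        have := hC.smul_mem' h2 (a := (b - a) / (b - s))
          (div_nonneg (by linarith) (by linarith))
        convert this using 1
        rw [hu, hv]
        have : b - s ≠ 0 := by linarith
        match_scalars <;> field_simp <;> ring
    have hfuv := map_coneComp hf huv
    have hfu : f u ∈ Γ := hf ⟨_, huC, rfl⟩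
    have hfv : f v ∈ Γ := hf ⟨_, hvC, rfl⟩
    have hy' : (b - a) • f y = f u + f v := by
      rw [← map_add, ← map_smul]; congr 1; rw [hu, hv]; module
    have hx' : (b - a) • f x = b • f u + a • f v := by
      rw [← map_smul, ← map_smul, ← map_smul, ← map_add]; congr 1; rw [hu, hv]; module
    have hv0 : f v ≠ 0 := by
      intro h
      rw [h] at hfuv hy'
      rw [coneComp_zero hΓ hfu hfuv, add_zero] at hy'
      rcases smul_eq_zero.1 hy' with h | h
      · linarith
      · exact hy0 h
    have hu0 : f u ≠ 0 := by
      intro h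
      rw [h] at hfuv
      exact hv0 (coneComp_zero hΓ hfv (coneComp_symm hΓ hfuv))
    obtain ⟨p, q, hp, hq, g1, g2, g3⟩ := hilbertD_approx hΓ hfu hfv hu0 hv0 hfuv he
    have hpq : p ≤ q := cone_coeff_le hΓ hfv hv0 g1 g2
    have hD := hΔ u huC v hvC hfuv
    unfold coneLE at g1 g2
    have i1 : hilbertD Γ (f x) (f y) ≤
        Real.log (((a + q * b) / (1 + q)) / ((a + p * b) / (1 + p))) := by
      apply hilbertD_le hΓ hfx hfy hx0 hy0 (by positivity) (by positivity)
      · unfold coneLE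
        have := hΓ.smul_mem' g1 (a := 1 / (1 + p)) (by positivity)
        convert this using 1
        rw [hu, hv]
        simp only [map_sub, map_smul]
        match_scalars <;> field_simp <;> ring
      · unfold coneLE
        have := hΓ.smul_mem' g2 (a := 1 / (1 + q)) (by positivity)
        convert this using 1
        rw [hu, hv]
        simp only [map_sub, map_smul]
        match_scalars <;> field_simp <;> ring
    have i2 := scal_ineq p q (b / a) hp hpq (by rw [one_le_div ha0]; exact hab.le)
    have i3 : Real.log (((a + q * b) / (1 + q)) / ((a + p * b) / (1 + p))) =
        Real.log (1 + q * (b / a)) - Real.log (1 + p * (b / a)) -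
          (Real.log (1 + q) - Real.log (1 + p)) := by
      rw [← Real.log_div (by positivity) (by positivity),
        ← Real.log_div (by positivity) (by positivity),
        ← Real.log_div (by positivity) (by positivity)]
      congr 1
      field_simp
    rw [← i3] at i2
    refine i1.trans (i2.trans ?_)
    rw [hlog]
    apply mul_le_mul_of_nonneg_right _ (by linarith)
    apply tanh_mono
    rw [g3]
    linarith
  have hcont : Filter.Tendsto
      (fun e : ℝ => Real.tanh ((Δ + 2 * e) / 4) * (hilbertD C x y + 4 * e))
      (nhdsWithin 0 (Set.Ioi 0)) (nhds (Real.tanh (Δ / 4) * hilbertD C x y)) := by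
    have hc0 : Continuous
        (fun e : ℝ => Real.tanh ((Δ + 2 * e) / 4) * (hilbertD C x y + 4 * e)) := by
      have := tanh_cont
      fun_prop
    have := hc0.tendsto 0
    simp only [mul_zero, add_zero] at this
    exact this.mono_left nhdsWithin_le_nhds
  apply ge_of_tendsto hcont
  filter_upwards [self_mem_nhdsWithin] with e he
  exact main e he

/-- the lower estimate -/
lemma lower (hC : IsCone C) (hΓ : IsCone Γ) (hf : f '' C ⊆ Γ) {l : ℝ} (hl0 : 0 ≤ l)
    (hl : ∀ x ∈ C, ∀ y ∈ C, coneComp C x y → coneComp Γ (f x) (f y) →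
        hilbertD Γ (f x) (f y) ≤ l * hilbertD C x y)
    {u v : V} (hu : u ∈ C) (hv : v ∈ C) (hc : coneComp Γ (f u) (f v)) :
    Real.tanh (hilbertD Γ (f u) (f v) / 4) ≤ l := by
  have hfu : f u ∈ Γ := hf ⟨_, hu, rfl⟩
  have hfv : f v ∈ Γ := hf ⟨_, hv, rfl⟩
  by_cases hv0 : f v = 0
  · rw [hv0] at hc ⊢
    rw [coneComp_zero hΓ hfu hc, hilbertD_zero]
    simpa using hl0
  have hcs := coneComp_symm hΓ hc
  have hu0 : f u ≠ 0 := by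
    intro h
    rw [h] at hcs
    exact hv0 (coneComp_zero hΓ hfv hcs)
  obtain ⟨D, hD⟩ : ∃ D, D = hilbertD Γ (f u) (f v) := ⟨_, rfl⟩
  obtain ⟨q, hq⟩ : ∃ q, q = coneM Γ (f u) (f v) := ⟨_, rfl⟩
  obtain ⟨n, hn⟩ : ∃ n, n = coneM Γ (f v) (f u) := ⟨_, rfl⟩
  have hq0 : 0 < q := hq ▸ coneM_pos hΓ hfv hv0 hc
  have hn0 : 0 < n := hn ▸ coneM_pos hΓ hfu hu0 hcs
  have hqn : q * n = Real.exp (D / 2) * Real.exp (D / 2) := by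
    rw [← Real.exp_add, add_halves, hD, hilbertD, ← hq, ← hn, Real.exp_log (by positivity)]
  rw [← hD, show D / 4 = (D / 2) / 2 by ring]
  apply scal_lower
  intro b hb
  rw [Real.exp_neg]
  have hE := Real.exp_pos (D / 2)
  generalize Real.exp (D / 2) = E at *
  obtain ⟨r, hr⟩ : ∃ r, r = E / q := ⟨_, rfl⟩
  have hr0 : 0 < r := by rw [hr]; positivity
  have hrq : r * q = E := by rw [hr]; field_simp
  have hrn : r = E⁻¹ * n := by
    rw [hr, div_eq_iff hq0.ne']
    field_simp
    linarith
  have hb0 : 0 < b := by linarith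
  obtain ⟨x, hx⟩ : ∃ x, x = (r * b) • u + v := ⟨_, rfl⟩
  obtain ⟨y, hy⟩ : ∃ y, y = r • u + v := ⟨_, rfl⟩
  have hxC : x ∈ C := hx ▸ hC.add_mem' (hC.smul_mem' hu (by positivity)) hv
  have hyC : y ∈ C := hy ▸ hC.add_mem' (hC.smul_mem' hu hr0.le) hv
  have k1 : coneLE C ((1 : ℝ) • y) x := by
    unfold coneLE
    have := hC.smul_mem' hu (a := r * (b - 1)) (mul_nonneg hr0.le (by linarith))
    convert this using 1
    rw [hx, hy]; module
  have k2 : coneLE C x (b • y) := by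
    unfold coneLE
    have := hC.smul_mem' hv (a := b - 1) (by linarith)
    convert this using 1
    rw [hx, hy]; module
  have hxy : coneComp C x y := ⟨⟨1, one_pos, k1⟩, ⟨b, hb0, k2⟩⟩
  have hfx : f x = (r * b) • f u + f v := by rw [hx]; simp
  have hfy : f y = r • f u + f v := by rw [hy]; simp
  have hfxΓ : f x ∈ Γ := hf ⟨_, hxC, rfl⟩
  have hfyΓ : f y ∈ Γ := hf ⟨_, hyC, rfl⟩
  have nz : ∀ c : ℝ, 0 < c → c • f u + f v ≠ 0 := by
    intro c hc0 h
    apply hv0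
    apply hΓ.eq_zero' hfv
    rw [← eq_neg_of_add_eq_zero_left h]
    exact hΓ.smul_mem' hfu hc0.le
  have hx0 : f x ≠ 0 := hfx ▸ nz _ (by positivity)
  have hy0 : f y ≠ 0 := hfy ▸ nz _ (by positivity)
  have hcxy := map_coneComp hf hxy
  have m1 := hl x hxC y hyC hxy hcxy
  have m2 := hilbertD_le hC hxC hyC (map_ne hx0) (map_ne hy0) one_pos hb0 k1 k2
  rw [div_one] at m2
  refine le_trans ?_ (m1.trans (mul_le_mul_of_nonneg_left m2 hl0))
  apply le_hilbertD hΓ hfxΓ hfyΓ hx0 hy0 hcxy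
  intro t s ht hs j1 j2
  have hs' : 1 + E * b ≤ s * (1 + E) := by
    by_cases hsb : b ≤ s
    · nlinarith
    push Not at hsb
    have hpos : 0 < r * (b - s) := mul_pos hr0 (by linarith)
    have : coneLE Γ (f u) (((s - 1) / (r * (b - s))) • f v) := by
      unfold coneLE at *
      have := hΓ.smul_mem' j2 (inv_pos.2 hpos).le
      convert this using 1
      rw [hfx, hfy]
      have : b - s ≠ 0 := by linarith
      match_scalars <;> field_simp <;> ring
    have := coneM_le hΓ hfv hv0 hc this
    rw [← hq, le_div_iff₀ hpos] at this
    have e : q * (r * (b - s)) = E * (b - s) := by rw [← hrq]; ring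
    rw [e] at this
    linarith
  have ht' : t * (1 + E⁻¹) ≤ 1 + E⁻¹ * b := by
    have hEi : 0 < E⁻¹ := inv_pos.2 hE
    by_cases hta : t ≤ 1
    · nlinarith
    push Not at hta
    have hpos : 0 < t - 1 := by linarith
    have : coneLE Γ (f v) (((r * (b - t)) / (t - 1)) • f u) := by
      unfold coneLE at *
      have := hΓ.smul_mem' j1 (inv_pos.2 hpos).le
      convert this using 1
      rw [hfx, hfy]
      match_scalars <;> field_simp <;> ring
    have := coneM_le hΓ hfu hu0 hcs this
    rw [← hn, le_div_iff₀ hpos, hrn] at this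
    have : n * (t - 1) ≤ n * (E⁻¹ * (b - t)) := by linarith
    have := le_of_mul_le_mul_left this hn0
    linarith
  have hEi : 0 < E⁻¹ := inv_pos.2 hE
  rw [← Real.log_div (by positivity) (by positivity),
    ← Real.log_div (by positivity) (by positivity),
    ← Real.log_div (by positivity) (by positivity)]
  apply Real.log_le_log (by positivity)
  rw [div_div_div_eq, div_le_div_iff₀ (by positivity) ht]
  calc (1 + E * b) * (1 + E⁻¹) * t = (1 + E * b) * (t * (1 + E⁻¹)) := by ring
    _ ≤ (s * (1 + E)) * (1 + E⁻¹ * b) := by gcongr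
    _ = s * ((1 + E⁻¹ * b) * (1 + E)) := by ring

end main

/-- **Birkhoff–Hopf theorem**: the smallest Lipschitz constant of a cone-preserving linear map
with respect to the Hilbert projective metrics equals `tanh (diam (f(C); Γ) / 4)`. -/
theorem birkhoff_hopf
    {V W : Type*} [AddCommGroup V] [Module ℝ V] [AddCommGroup W] [Module ℝ W]
    (C : Set V) (Γ : Set W) (hC : IsCone C) (hΓ : IsCone Γ)
    (f : V →ₗ[ℝ] W) (hf : f '' C ⊆ Γ) :
    sInf {l : ℝ | 0 ≤ l ∧ ∀ x ∈ C, ∀ y ∈ C, coneComp C x y → coneComp Γ (f x) (f y) →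
        hilbertD Γ (f x) (f y) ≤ l * hilbertD C x y}
      = tanh4 (projDiam Γ (f '' C)) := by
  have hcont : Continuous fun d : ℝ => Real.tanh (d / 4) := by
    have := tanh_cont
    fun_prop
  have hub : ∀ u ∈ C, ∀ v ∈ C, coneComp Γ (f u) (f v) →
      ((hilbertD Γ (f u) (f v) : ℝ) : EReal) ≤ projDiam Γ (f '' C) := by
    intro u hu v hv h
    exact le_sSup ⟨f u, ⟨u, hu, rfl⟩, f v, ⟨v, hv, rfl⟩, h, rfl⟩
  apply IsLeast.csInf_eq
  unfold tanh4
  by_cases hT : projDiam Γ (f '' C) = ⊤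
  · rw [if_pos hT]
    refine ⟨⟨zero_le_one, fun x hx y hy h _ => ?_⟩, ?_⟩
    · rw [one_mul]
      exact nonexp hC hΓ hf hx hy h
    · rintro l ⟨hl0, hl⟩
      by_contra! hl1
      have hbig : ∃ d : ℝ, l < Real.tanh (d / 4) := by
        refine ⟨4 * Real.artanh ((l + 1) / 2), ?_⟩
        rw [mul_div_cancel_left₀ _ (by norm_num : (4 : ℝ) ≠ 0),
          Real.tanh_artanh ⟨by linarith, by linarith⟩]
        linarith
      obtain ⟨d, hd⟩ := hbig
      have hlt : (d : EReal) < projDiam Γ (f '' C) := by rw [hT]; exact EReal.coe_lt_top d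
      obtain ⟨z, ⟨_, ⟨u, hu, rfl⟩, _, ⟨v, hv, rfl⟩, hc, rfl⟩, hz⟩ := lt_sSup_iff.1 hlt
      have h1 := lower hC hΓ hf hl0 hl hu hv hc
      have h2 := EReal.coe_lt_coe_iff.1 hz
      have := tanh_mono (show d / 4 ≤ hilbertD Γ (f u) (f v) / 4 by linarith)
      linarith
  · rw [if_neg hT]
    have h00 : coneComp Γ (f 0) (f 0) := by
      have h0 := hΓ.zero_mem'
      refine ⟨⟨1, one_pos, ?_⟩, ⟨1, one_pos, ?_⟩⟩ <;> simpa [coneLE] using h0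
    have hz := hub 0 hC.zero_mem' 0 hC.zero_mem' h00
    rw [map_zero, hilbertD_zero] at hz
    have hB : projDiam Γ (f '' C) ≠ ⊥ := by
      intro h
      rw [h] at hz
      simp at hz
    obtain ⟨Δ, hΔ⟩ : ∃ Δ : ℝ, (Δ : EReal) = projDiam Γ (f '' C) :=
      ⟨_, EReal.coe_toReal hT hB⟩
    rw [← hΔ] at hz ⊢
    have hΔ0 : 0 ≤ Δ := by exact_mod_cast hz
    rw [EReal.toReal_coe]
    refine ⟨⟨?_, fun x hx y hy h _ => ?_⟩, ?_⟩
    · have := tanh_mono (show 0 ≤ Δ / 4 by positivity)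
      simpa using this
    · refine contr hC hΓ hf ?_ hΔ0 hx hy h
      intro u hu v hv h
      have := hub u hu v hv h
      rw [← hΔ] at this
      exact_mod_cast this
    · rintro l ⟨hl0, hl⟩
      have hall : ∀ d : ℝ, d < Δ → Real.tanh (d / 4) ≤ l := by
        intro d hd
        have hlt : (d : EReal) < projDiam Γ (f '' C) := by
          rw [← hΔ]; exact_mod_cast hd
        obtain ⟨z, ⟨_, ⟨u, hu, rfl⟩, _, ⟨v, hv, rfl⟩, hc, rfl⟩, hz⟩ := lt_sSup_iff.1 hlt
        have h1 := lower hC hΓ hf hl0 hl hu hv hc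
        have h2 := EReal.coe_lt_coe_iff.1 hz
        have := tanh_mono (show d / 4 ≤ hilbertD Γ (f u) (f v) / 4 by linarith)
        linarith
      have ht := (hcont.tendsto Δ).mono_left (nhdsWithin_le_nhds (s := Set.Iio Δ))
      apply le_of_tendsto ht
      filter_upwards [self_mem_nhdsWithin] with d hd
      exact hall d hd
end

section
/- Let f : 𝒱 → W be weakly multilinear with f(𝒞) ⊆ Γ, where 𝒞 = C_1 × ⋯ × C_ν for cones C_i ⊆ V_i and Γ ⊆ W is a cone. Then for all x, y ∈ 𝒞 such that x_i ∼_{C_i} y_i for every i = 1, …, ν and f(x) ∼_Γ f(y), one has d_Γ(f(x), f(y)) ≤ Σ_{i=1}^ν κ_i(f) · d_{C_i}(x_i, y_i), where κ_i(f) is the mode-i Birkhoff contraction ratio of f. -/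
/-- A map on a finite product of vector spaces is weakly multilinear if it coincides with a
multilinear map of a subcollection of its arguments. -/
def WeaklyMultilinear {ι : Type*} [Fintype ι] [DecidableEq ι] {V : ι → Type*}
    [∀ i, AddCommGroup (V i)] [∀ i, Module ℝ (V i)] {W : Type*} [AddCommGroup W] [Module ℝ W]
    (f : (∀ i, V i) → W) : Prop :=
  ∃ (s : Finset ι) (g : MultilinearMap ℝ (fun j : s => V j) W),
    ∀ x : ∀ i, V i, f x = g (fun j => x j)

/-- The mode-`i` Birkhoff contraction ratio
`κ_i(f) = sup_{z ∈ 𝒞} tanh (diam (f|_z^i (C_i); Γ) / 4)`. -/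
noncomputable def modeKappa {ι : Type*} [Fintype ι] [DecidableEq ι] {V : ι → Type*}
    [∀ i, AddCommGroup (V i)] [∀ i, Module ℝ (V i)] {W : Type*} [AddCommGroup W] [Module ℝ W]
    (C : ∀ i, Set (V i)) (Γ : Set W) (f : (∀ i, V i) → W) (i : ι) : ℝ :=
  sSup {r : ℝ | ∃ z : ∀ j, V j, (∀ j, z j ∈ C j) ∧
    r = tanh4 (projDiam Γ ((fun xi => f (Function.update z i xi)) '' C i))}

namespace BH

section cone
variable {V : Type*} [AddCommGroup V] [Module ℝ V] {C : Set V}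

lemma smul_mem (hC : IsCone C) {x : V} (hx : x ∈ C) {a : ℝ} (ha : 0 ≤ a) : a • x ∈ C :=
  hC.2.1 x hx a ha

lemma zero_mem (hC : IsCone C) : (0 : V) ∈ C := by
  have : (0 : V) ∈ C ∩ (-C) := by rw [hC.2.2]; rfl
  exact this.1

lemma add_mem (hC : IsCone C) {x y : V} (hx : x ∈ C) (hy : y ∈ C) : x + y ∈ C := by
  have h := hC.1 hx hy (show (0 : ℝ) ≤ 1/2 by norm_num) (show (0 : ℝ) ≤ 1/2 by norm_num)
    (by norm_num)
  have h2 := smul_mem hC h (a := 2) (by norm_num)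
  have e : (2 : ℝ) • ((1/2 : ℝ) • x + (1/2 : ℝ) • y) = x + y := by module
  rwa [e] at h2

lemma eq_zero (hC : IsCone C) {x : V} (hx : x ∈ C) (hx' : -x ∈ C) : x = 0 := by
  have : x ∈ C ∩ (-C) := ⟨hx, hx'⟩
  rw [hC.2.2] at this
  exact this

lemma comb (hC : IsCone C) {x y w : V} (hx : x ∈ C) (hy : y ∈ C) {a b : ℝ} (ha : 0 ≤ a)
    (hb : 0 ≤ b) (e : w = a • x + b • y) : w ∈ C := by
  rw [e]; exact add_mem hC (smul_mem hC hx ha) (smul_mem hC hy hb)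

lemma nonneg_of (hC : IsCone C) {x : V} (hx : x ∈ C) (h0 : x ≠ 0) {a : ℝ} (h : a • x ∈ C) :
    0 ≤ a := by
  by_contra hn
  push Not at hn
  apply h0
  apply eq_zero hC hx
  have := smul_mem hC h (a := (-a)⁻¹) (by rw [inv_nonneg]; linarith)
  rw [smul_smul] at this
  have e : (-a)⁻¹ * a = -1 := by
    rw [inv_neg, neg_mul, inv_mul_cancel₀ hn.ne]
  rw [e] at this
  simpa using this

lemma comp_symm (hC : IsCone C) {x y : V} (h : coneComp C x y) : coneComp C y x := by
  obtain ⟨⟨α, ha, h1⟩, β, hb, h2⟩ := h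
  unfold coneComp coneLE at *
  refine ⟨⟨β⁻¹, by positivity, ?_⟩, α⁻¹, by positivity, ?_⟩
  · have := smul_mem hC h2 (a := β⁻¹) (by positivity)
    rwa [smul_sub, smul_smul, inv_mul_cancel₀ hb.ne', one_smul] at this
  · have := smul_mem hC h1 (a := α⁻¹) (by positivity)
    rwa [smul_sub, smul_smul, inv_mul_cancel₀ ha.ne', one_smul] at this

lemma comp_trans (hC : IsCone C) {x y z : V} (h : coneComp C x y) (h' : coneComp C y z) :
    coneComp C x z := by
  obtain ⟨⟨α, ha, h1⟩, β, hb, h2⟩ := h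
  obtain ⟨⟨α', ha', h1'⟩, β', hb', h2'⟩ := h'
  unfold coneComp coneLE at *
  refine ⟨⟨α * α', by positivity, ?_⟩, β * β', by positivity, ?_⟩
  · exact comb hC h1 h1' zero_le_one ha.le (by module)
  · exact comb hC h2 h2' zero_le_one hb.le (by module)

lemma comp_refl (hC : IsCone C) (x : V) : coneComp C x x := by
  refine ⟨⟨1, one_pos, ?_⟩, 1, one_pos, ?_⟩ <;> simpa [coneLE] using zero_mem hC

lemma comp_zero (hC : IsCone C) {x : V} (hx : x ∈ C) (h : coneComp C x 0) : x = 0 := by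
  obtain ⟨-, β, hb, h2⟩ := h
  apply eq_zero hC hx
  simpa [coneLE] using h2

lemma comp_ne (hC : IsCone C) {x y : V} (hx : x ∈ C) (h : coneComp C x y) (h0 : x ≠ 0) :
    y ≠ 0 := by
  rintro rfl
  exact h0 (comp_zero hC hx h)

/-- positive lower bound for the set defining M -/
lemma lower (hC : IsCone C) {x y : V} (hy : y ∈ C) (h : coneComp C x y) (h0 : y ≠ 0) :
    ∃ α : ℝ, 0 < α ∧ ∀ β ∈ {β : ℝ | coneLE C x (β • y)}, α ≤ β := by
  obtain ⟨⟨α, ha, h1⟩, -⟩ := h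
  refine ⟨α, ha, fun β hb => ?_⟩
  have : (β - α) • y ∈ C := comb hC h1 hb zero_le_one zero_le_one (by module)
  have := nonneg_of hC hy h0 this
  linarith

lemma M_pos (hC : IsCone C) {x y : V} (hy : y ∈ C) (h : coneComp C x y) (h0 : y ≠ 0) :
    0 < coneM C x y := by
  obtain ⟨α, ha, hl⟩ := lower hC hy h h0
  obtain ⟨-, β, hb, h2⟩ := h
  exact ha.trans_le (le_csInf ⟨β, h2⟩ hl)

lemma M_le (hC : IsCone C) {x y : V} (hy : y ∈ C) (h : coneComp C x y) (h0 : y ≠ 0) {β : ℝ}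
    (hb : coneLE C x (β • y)) : coneM C x y ≤ β := by
  obtain ⟨α, ha, hl⟩ := lower hC hy h h0
  exact csInf_le ⟨α, hl⟩ hb

lemma le_of_M_lt (hC : IsCone C) {x y : V} (hy : y ∈ C) (h : coneComp C x y) {β : ℝ}
    (hb : coneM C x y < β) : coneLE C x (β • y) := by
  obtain ⟨-, β', hb', h2⟩ := h
  obtain ⟨γ, hg, hlt⟩ := exists_lt_of_csInf_lt ⟨β', h2⟩ hb
  exact comb hC hg hy zero_le_one (b := β - γ) (by linarith) (by module)

lemma D_zero : hilbertD C (0 : V) 0 = 0 := by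
  have : coneM C (0 : V) 0 = 0 := by
    unfold coneM coneLE
    by_cases h : (0 : V) ∈ C <;> simp [h]
  simp [hilbertD, this]

lemma D_le (hC : IsCone C) {x y : V} (hx : x ∈ C) (hy : y ∈ C) (h : coneComp C x y)
    (h0 : x ≠ 0) {β γ : ℝ} (hb : coneLE C x (β • y)) (hg : coneLE C y (γ • x)) :
    hilbertD C x y ≤ Real.log (β * γ) := by
  have hy0 := comp_ne hC hx h h0
  have h' := comp_symm hC h
  have p1 := M_pos hC hy h hy0
  have p2 := M_pos hC hx h' h0
  apply Real.log_le_log (by positivity)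
  have m1 := M_le hC hy h hy0 hb
  have m2 := M_le hC hx h' h0 hg
  have hb0 : 0 ≤ β := p1.le.trans m1
  gcongr

lemma D_symm {x y : V} : hilbertD C x y = hilbertD C y x := by
  unfold hilbertD; rw [mul_comm]

/-- approximation principle -/
lemma tendsto_aux {p q A : ℝ} {F : ℝ → ℝ} (hF : ContinuousAt F (p * q))
    (H : ∀ b c, p < b → q < c → A ≤ F (b * c)) : A ≤ F (p * q) := by
  have t : Filter.Tendsto (fun e : ℝ => (p + e) * (q + e)) (nhdsWithin 0 (Set.Ioi 0))
      (nhds (p * q)) := by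
    have : Continuous (fun e : ℝ => (p + e) * (q + e)) := by fun_prop
    have := this.tendsto 0
    simp only [add_zero] at this
    exact this.mono_left nhdsWithin_le_nhds
  have t2 := hF.tendsto.comp t
  refine ge_of_tendsto t2 ?_
  filter_upwards [self_mem_nhdsWithin] with e he
  have he : 0 < e := he
  exact H _ _ (by linarith) (by linarith)

lemma one_le_mul (hC : IsCone C) {x y : V} (hx : x ∈ C) (h0 : x ≠ 0) {β γ : ℝ} (hb0 : 0 ≤ β)
    (hb : coneLE C x (β • y)) (hg : coneLE C y (γ • x)) : 1 ≤ β * γ := by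
  have : (β * γ - 1) • x ∈ C := comb hC hb hg zero_le_one hb0 (by module)
  have := nonneg_of hC hx h0 this
  linarith

lemma one_le_MM (hC : IsCone C) {x y : V} (hx : x ∈ C) (hy : y ∈ C) (h : coneComp C x y)
    (h0 : x ≠ 0) : 1 ≤ coneM C x y * coneM C y x := by
  have hy0 := comp_ne hC hx h h0
  have h' := comp_symm hC h
  have p1 := M_pos hC hy h hy0
  have p2 := M_pos hC hx h' h0
  refine tendsto_aux (F := id) continuousAt_id fun b c hb hc => ?_
  exact one_le_mul hC hx h0 (p1.trans hb).le (le_of_M_lt hC hy h hb) (le_of_M_lt hC hx h' hc)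

lemma D_nonneg (hC : IsCone C) {x y : V} (hx : x ∈ C) (hy : y ∈ C) (h : coneComp C x y) :
    0 ≤ hilbertD C x y := by
  by_cases h0 : x = 0
  · subst h0
    have := comp_zero hC hy (comp_symm hC h)
    subst this
    rw [D_zero]
  · exact Real.log_nonneg (one_le_MM hC hx hy h h0)

lemma D_self (hC : IsCone C) {x : V} (hx : x ∈ C) : hilbertD C x x = 0 := by
  by_cases h0 : x = 0
  · subst h0; exact D_zero
  · apply le_antisymm _ (D_nonneg hC hx hx (comp_refl hC x))
    have e : coneLE C x ((1 : ℝ) • x) := by simpa [coneLE] using zero_mem hC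
    simpa using D_le hC hx hx (comp_refl hC x) h0 e e

lemma D_triangle (hC : IsCone C) {x y z : V} (hx : x ∈ C) (hy : y ∈ C) (hz : z ∈ C)
    (h : coneComp C x y) (h' : coneComp C y z) :
    hilbertD C x z ≤ hilbertD C x y + hilbertD C y z := by
  have hxz := comp_trans hC h h'
  by_cases h0 : x = 0
  · subst h0
    have := comp_zero hC hy (comp_symm hC h)
    subst this
    have := comp_zero hC hz (comp_symm hC h')
    subst this
    simp [D_zero]
  have hy0 := comp_ne hC hx h h0
  have hz0 := comp_ne hC hx hxz h0
  have p1 := M_pos hC hy h hy0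
  have p2 := M_pos hC hx (comp_symm hC h) h0
  have p3 := M_pos hC hz h' hz0
  have p4 := M_pos hC hy (comp_symm hC h') hy0
  rw [hilbertD, hilbertD, hilbertD, ← Real.log_mul (by positivity) (by positivity)]
  have key : ∀ {a b c : V}, a ∈ C → b ∈ C → c ∈ C → coneComp C a b → coneComp C b c → b ≠ 0 →
      c ≠ 0 → coneM C a c ≤ coneM C a b * coneM C b c := by
    intro a b c ha hb hc hab hbc hb0 hc0
    refine tendsto_aux (F := id) continuousAt_id fun s t hs ht => ?_
    apply M_le hC hc (comp_trans hC hab hbc) hc0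
    have q := M_pos hC hb hab hb0
    show coneLE C a ((s * t) • c)
    exact comb hC (le_of_M_lt hC hb hab hs) (le_of_M_lt hC hc hbc ht) zero_le_one
      (q.trans hs).le (by module)
  have k1 := key hx hy hz h h' hy0 hz0
  have k2 := key hz hy hx (comp_symm hC h') (comp_symm hC h) hy0 h0
  have p5 := M_pos hC hz hxz hz0
  have p6 := M_pos hC hx (comp_symm hC hxz) h0
  apply Real.log_le_log (by positivity)
  calc _ ≤ (coneM C x y * coneM C y z) * (coneM C z y * coneM C y x) := by gcongr
    _ = _ := by ring

end cone

/-- the scalar inequality -/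
lemma scalar {l m r : ℝ} (hl : 0 < l) (hm : 0 < m) (hlm : 1 ≤ l * m) (hr : 1 ≤ r) :
    Real.log ((r * l + 1) * (1 + m) / ((1 + l) * (r + m))) ≤
      (√(l * m) - 1) / (√(l * m) + 1) * Real.log r := by
  set k := (√(l * m) - 1) / (√(l * m) + 1) with hk
  have hs : √(l * m) ^ 2 = l * m := Real.sq_sqrt (by positivity)
  have hs0 : 0 < √(l * m) := Real.sqrt_pos.2 (by positivity)
  set s := √(l * m) with hsdef
  let F : ℝ → ℝ := fun r => k * Real.log r - (Real.log (r * l + 1) + Real.log (1 + m)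
    - Real.log (1 + l) - Real.log (r + m))
  have hd : ∀ t, 0 < t → HasDerivAt F (k * t⁻¹ - (l / (t * l + 1) - 1 / (t + m))) t := by
    intro t ht
    have d1 := (Real.hasDerivAt_log ht.ne').const_mul k
    have d2 : HasDerivAt (fun r : ℝ => Real.log (r * l + 1)) (l / (t * l + 1)) t := by
      have : HasDerivAt (fun r : ℝ => r * l + 1) l t := by
        simpa using ((hasDerivAt_id t).mul_const l).add_const 1
      exact this.log (by positivity)
    have d3 : HasDerivAt (fun r : ℝ => Real.log (r + m)) (1 / (t + m)) t := by
      have : HasDerivAt (fun r : ℝ => r + m) 1 t := (hasDerivAt_id t).add_const m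
      exact this.log (by positivity)
    exact d1.sub (((d2.add_const (Real.log (1 + m))).sub_const (Real.log (1 + l))).sub d3)
  have hmono : MonotoneOn F (Set.Ici 1) := by
    apply monotoneOn_of_deriv_nonneg (convex_Ici 1)
    · intro t ht
      have : (1 : ℝ) ≤ t := ht
      exact (hd t (by linarith)).continuousAt.continuousWithinAt
    · intro t ht
      rw [interior_Ici] at ht
      have : (1 : ℝ) < t := ht
      exact (hd t (by linarith)).differentiableAt.differentiableWithinAt
    · intro t ht
      rw [interior_Ici] at ht
      have : (1 : ℝ) < t := ht
      have ht0 : 0 < t := by linarith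
      rw [(hd t ht0).deriv]
      have e : k * t⁻¹ - (l / (t * l + 1) - 1 / (t + m)) =
          (s - 1) * (t * l - s) ^ 2 / ((s + 1) * t * (t * l + 1) * (t * l + s ^ 2)) := by
        have hm' : m = s ^ 2 / l := by rw [hs]; field_simp
        rw [hm', hk]
        field_simp
        ring
      rw [e]
      have : 1 ≤ s := by rw [hsdef]; exact Real.one_le_sqrt.2 hlm
      have : 0 ≤ s - 1 := by linarith
      positivity
  have h1 : F 1 = 0 := by
    simp only [F, Real.log_one]; ring_nf
  have := hmono (Set.mem_Ici.2 le_rfl) (Set.mem_Ici.2 hr) hr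
  rw [h1] at this
  rw [Real.log_div (by positivity) (by positivity), Real.log_mul (by positivity) (by positivity),
    Real.log_mul (by positivity) (by positivity)]
  simp only [F] at this
  linarith

lemma tanh_eq {q : ℝ} (hq : 0 < q) : (√q - 1) / (√q + 1) = Real.tanh (Real.log q / 4) := by
  have h2 : √q = Real.exp (Real.log q / 4) ^ 2 := by
    rw [Real.sqrt_eq_iff_mul_self_eq hq.le (by positivity)]
    rw [← pow_add, ← Real.exp_nat_mul]
    norm_num
    rw [show (4 : ℝ) * (Real.log q / 4) = Real.log q by ring, Real.exp_log hq]
  rw [h2, Real.tanh_eq_sinh_div_cosh, Real.sinh_eq, Real.cosh_eq, Real.exp_neg]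
  have := Real.exp_pos (Real.log q / 4)
  field_simp

lemma tanh_mono {a b : ℝ} (h : a ≤ b) : Real.tanh a ≤ Real.tanh b := by
  rw [Real.tanh_eq_sinh_div_cosh, Real.tanh_eq_sinh_div_cosh,
    div_le_div_iff₀ (Real.cosh_pos _) (Real.cosh_pos _)]
  have : 0 ≤ Real.sinh (b - a) := Real.sinh_nonneg_iff.2 (by linarith)
  rw [Real.sinh_sub] at this
  linarith

section lin
variable {V : Type*} [AddCommGroup V] [Module ℝ V] {C : Set V}
variable {W : Type*} [AddCommGroup W] [Module ℝ W] {Γ : Set W}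

lemma map_comp (L : V →ₗ[ℝ] W) (hL : ∀ x ∈ C, L x ∈ Γ) {x y : V} (h : coneComp C x y) :
    coneComp Γ (L x) (L y) := by
  obtain ⟨⟨α, ha, h1⟩, β, hb, h2⟩ := h
  refine ⟨⟨α, ha, ?_⟩, β, hb, ?_⟩
  · simpa [coneLE] using hL _ h1
  · simpa [coneLE] using hL _ h2

/-- Birkhoff-Hopf -/
lemma birkhoff (hC : IsCone C) (hΓ : IsCone Γ) (L : V →ₗ[ℝ] W) (hL : ∀ x ∈ C, L x ∈ Γ) {κ : ℝ}
    (hk0 : 0 ≤ κ)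
    (hk : ∀ u ∈ C, ∀ v ∈ C, coneComp Γ (L u) (L v) →
      Real.tanh (hilbertD Γ (L u) (L v) / 4) ≤ κ)
    {x y : V} (hx : x ∈ C) (hy : y ∈ C) (h : coneComp C x y) :
    hilbertD Γ (L x) (L y) ≤ κ * hilbertD C x y := by
  have hLc := map_comp L hL h
  by_cases hLx : L x = 0
  · have : L y = 0 := comp_zero hΓ (hL y hy) (by rw [← hLx]; exact comp_symm hΓ hLc)
    rw [hLx, this, D_zero]
    exact mul_nonneg hk0 (D_nonneg hC hx hy h)
  have hx0 : x ≠ 0 := by rintro rfl; simp at hLx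
  have hy0 := comp_ne hC hx h hx0
  have h' := comp_symm hC h
  have p1 := M_pos hC hy h hy0
  have p2 := M_pos hC hx h' hx0
  have hMM := one_le_MM hC hx hy h hx0
  unfold hilbertD
  refine tendsto_aux (F := fun t => κ * Real.log t)
    (continuousAt_const.mul (Real.continuousAt_log (by positivity))) fun b c hb hc => ?_
  obtain ⟨b', hb', hb'b⟩ := exists_between hb
  obtain ⟨c', hc', hc'c⟩ := exists_between hc
  have hb0 : 0 < b := p1.trans hb
  have hc0 : 0 < c := p2.trans hc
  have hc'0 : 0 < c' := p2.trans hc'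
  have hbc : 1 < b * c := by
    calc 1 ≤ _ := hMM
      _ < b * c := by gcongr
  have Hb := le_of_M_lt hC hy h hb
  have Hc := le_of_M_lt hC hx h' hc
  have Hb' := le_of_M_lt hC hy h hb'
  have Hc' := le_of_M_lt hC hx h' hc'
  unfold coneLE at Hb Hc Hb' Hc'
  set u := c • x - y with hu
  set v := b • y - x with hv
  have ux : coneComp C u x := by
    refine ⟨⟨c - c', by linarith, ?_⟩, c, hc0, ?_⟩
    · exact comb hC Hc' hx zero_le_one le_rfl (by rw [hu]; module)
    · exact comb hC hy hx zero_le_one le_rfl (by rw [hu]; module)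
  have vy : coneComp C v y := by
    refine ⟨⟨b - b', by linarith, ?_⟩, b, hb0, ?_⟩
    · exact comb hC Hb' hx zero_le_one le_rfl (by rw [hv]; module)
    · exact comb hC hx hx zero_le_one le_rfl (by rw [hv]; module)
  have uv : coneComp C u v := comp_trans hC ux (comp_trans hC h (comp_symm hC vy))
  have wz := map_comp L hL uv
  have hw := hL u Hc
  have hz := hL v Hb
  have hw0 : L u ≠ 0 := by
    intro h0
    have h1 := map_comp L hL ux
    exact hLx (comp_zero hΓ (hL x hx) (by rw [← h0]; exact comp_symm hΓ h1))
  have hz0 := comp_ne hΓ hw wz hw0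
  have hK := hk u Hc v Hb wz
  have q1 := M_pos hΓ hz wz hz0
  have q2 := M_pos hΓ hw (comp_symm hΓ wz) hw0
  have hlogpos : 0 ≤ Real.log (b * c) := Real.log_nonneg hbc.le
  refine le_trans ?_ (mul_le_mul_of_nonneg_right hK hlogpos)
  unfold hilbertD
  rw [← tanh_eq (by positivity)]
  refine tendsto_aux (F := fun t => (√t - 1) / (√t + 1) * Real.log (b * c)) ?_ fun l m hl hm => ?_
  · apply Continuous.continuousAt
    have : ∀ t : ℝ, √t + 1 ≠ 0 := fun t => by positivity
    fun_prop (disch := exact this _)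
  have Hl := le_of_M_lt hΓ hz wz hl
  have Hm := le_of_M_lt hΓ hw (comp_symm hΓ wz) hm
  have hl0 := q1.trans hl
  have hm0 := q2.trans hm
  have hlm : 1 ≤ l * m := one_le_mul hΓ hw hw0 hl0.le Hl Hm
  have elm : l / c * (m * c) = l * m := by field_simp
  have hsc := scalar (l := l / c) (m := m * c) (by positivity) (by positivity)
    (by rw [elm]; exact hlm) hbc.le
  rw [elm] at hsc
  refine le_trans ?_ hsc
  have hpos : 0 < b * c - 1 := by linarith
  have eu : L u = c • L x - L y := by rw [hu]; simp
  have ev : L v = b • L y - L x := by rw [hv]; simp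
  unfold coneLE at Hl Hm
  have hβ : coneLE Γ (L x) (((b * l + 1) / (l + c)) • L y) := by
    unfold coneLE
    refine comb hΓ Hl hw (a := 1 / (l + c)) (b := 0) (by positivity) le_rfl ?_
    rw [eu, ev]
    match_scalars <;> field_simp <;> ring
  have hγ : coneLE Γ (L y) (((1 + c * m) / (b + m)) • L x) := by
    unfold coneLE
    refine comb hΓ Hm hw (a := 1 / (b + m)) (b := 0) (by positivity) le_rfl ?_
    rw [eu, ev]
    match_scalars <;> field_simp <;> ring
  have := D_le hΓ (hL x hx) (hL y hy) hLc hLx hβ hγ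
  refine le_trans this (le_of_eq ?_)
  congr 1
  field_simp
  ring

end lin

lemma tanh4_le_one (t : EReal) : tanh4 t ≤ 1 := by
  unfold tanh4
  split_ifs
  · rfl
  · exact (Real.tanh_lt_one _).le

lemma le_tanh4 {t : EReal} {d : ℝ} (h : (d : EReal) ≤ t) : Real.tanh (d / 4) ≤ tanh4 t := by
  unfold tanh4
  split_ifs with ht
  · exact (Real.tanh_lt_one _).le
  · apply tanh_mono
    have : d ≤ t.toReal := by
      rw [← EReal.coe_le_coe_iff, EReal.coe_toReal ht]
      · exact h
      · rintro rfl; simp at h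
    linarith

section main
variable {ι : Type*} [Fintype ι] [DecidableEq ι] {V : ι → Type*}
    [∀ i, AddCommGroup (V i)] [∀ i, Module ℝ (V i)] {W : Type*} [AddCommGroup W] [Module ℝ W]
    {C : ∀ i, Set (V i)} {Γ : Set W}

lemma le_kappa {f : (∀ i, V i) → W} {z : ∀ i, V i} (hz : ∀ i, z i ∈ C i) (i : ι) {u v : V i}
    (hu : u ∈ C i) (hv : v ∈ C i)
    (h : coneComp Γ (f (Function.update z i u)) (f (Function.update z i v))) :
    Real.tanh (hilbertD Γ (f (Function.update z i u)) (f (Function.update z i v)) / 4) ≤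
      modeKappa C Γ f i := by
  refine le_trans (le_tanh4 (t := projDiam Γ ((fun xi => f (Function.update z i xi)) '' C i)) ?_)
    (le_csSup ⟨1, ?_⟩ ⟨z, hz, rfl⟩)
  · exact le_sSup ⟨_, ⟨u, hu, rfl⟩, _, ⟨v, hv, rfl⟩, h, rfl⟩
  · rintro r ⟨z, -, rfl⟩
    exact tanh4_le_one _

lemma step (hC : ∀ i, IsCone (C i)) (hΓ : IsCone Γ)
    {f : (∀ i, V i) → W} (hwm : WeaklyMultilinear f)
    (hf : ∀ x : ∀ i, V i, (∀ i, x i ∈ C i) → f x ∈ Γ) {z : ∀ i, V i} (hz : ∀ i, z i ∈ C i)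
    (i : ι) {v : V i} (hv : v ∈ C i) (h : coneComp (C i) (z i) v) :
    coneComp Γ (f z) (f (Function.update z i v)) ∧
    hilbertD Γ (f z) (f (Function.update z i v)) ≤ modeKappa C Γ f i * hilbertD (C i) (z i) v := by
  have hk0 : 0 ≤ modeKappa C Γ f i := by
    have := le_kappa (Γ := Γ) (f := f) hz i (hz i) (hz i) (comp_refl hΓ _)
    rw [Function.update_eq_self, D_self hΓ (hf z hz)] at this
    simpa using this
  obtain ⟨s, g, hg⟩ := hwm
  by_cases hi : i ∈ s
  · let L : V i →ₗ[ℝ] W := g.toLinearMap (fun j => z j) ⟨i, hi⟩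
    have hLf : ∀ u, L u = f (Function.update z i u) := by
      intro u
      rw [hg]
      show g (Function.update _ _ _) = _
      congr 1
      funext j
      by_cases hj : j = ⟨i, hi⟩
      · subst hj; simp
      · have : (j : ι) ≠ i := fun e => hj (Subtype.ext e)
        simp [hj, this]
    have hLC : ∀ u ∈ C i, L u ∈ Γ := by
      intro u hu
      rw [hLf]
      apply hf
      intro j
      by_cases hj : j = i
      · subst hj; simpa using hu
      · simpa [hj] using hz j
    have ez : f z = L (z i) := by rw [hLf, Function.update_eq_self]
    rw [ez, ← hLf]
    refine ⟨map_comp L hLC h, birkhoff (hC i) hΓ L hLC hk0 ?_ (hz i) hv h⟩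
    intro u hu v hv huv
    rw [hLf, hLf] at *
    exact le_kappa hz i hu hv huv
  · have e : f (Function.update z i v) = f z := by
      rw [hg, hg]
      congr 1
      funext j
      have : (j : ι) ≠ i := by rintro rfl; exact hi j.2
      simp [this]
    rw [e, D_self hΓ (hf z hz)]
    exact ⟨comp_refl hΓ _, mul_nonneg hk0 (D_nonneg (hC i) (hz i) hv h)⟩

end main

end BH

/-- **Multilinear Birkhoff–Hopf theorem (upper bound)**: for a weakly multilinear cone-preserving
map, `d_Γ(f x, f y) ≤ Σ_i κ_i(f) d_{C_i}(x_i, y_i)`. -/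
theorem multilinear_birkhoff_hopf
    {ι : Type*} [Fintype ι] [DecidableEq ι] {V : ι → Type*}
    [∀ i, AddCommGroup (V i)] [∀ i, Module ℝ (V i)] {W : Type*} [AddCommGroup W] [Module ℝ W]
    (C : ∀ i, Set (V i)) (Γ : Set W) (hC : ∀ i, IsCone (C i)) (hΓ : IsCone Γ)
    (f : (∀ i, V i) → W) (hwm : WeaklyMultilinear f)
    (hf : ∀ x : ∀ i, V i, (∀ i, x i ∈ C i) → f x ∈ Γ) :
    ∀ x y : ∀ i, V i, (∀ i, x i ∈ C i) → (∀ i, y i ∈ C i) →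
      (∀ i, coneComp (C i) (x i) (y i)) → coneComp Γ (f x) (f y) →
      hilbertD Γ (f x) (f y) ≤ ∑ i, modeKappa C Γ f i * hilbertD (C i) (x i) (y i) := by
  intro x y hx hy hxy _
  have key : ∀ t : Finset ι, coneComp Γ (f x) (f (t.piecewise y x)) ∧
      hilbertD Γ (f x) (f (t.piecewise y x)) ≤
        ∑ i ∈ t, modeKappa C Γ f i * hilbertD (C i) (x i) (y i) := by
    intro t
    induction t using Finset.induction_on with
    | empty =>
      simp only [Finset.piecewise_empty, Finset.sum_empty]
      exact ⟨BH.comp_refl hΓ _, (BH.D_self hΓ (hf x hx)).le⟩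
    | insert i t hi ih =>
      have hz : ∀ s : Finset ι, ∀ j, s.piecewise y x j ∈ C j := by
        intro s j
        by_cases hj : j ∈ s
        · simpa [hj] using hy j
        · simpa [hj] using hx j
      have hzi : t.piecewise y x i = x i := by simp [hi]
      have st := BH.step hC hΓ hwm hf (hz t) i (hy i) (by rw [hzi]; exact hxy i)
      have hm := hf _ (hz (insert i t))
      rw [Finset.piecewise_insert] at hm ⊢
      rw [hzi] at st
      refine ⟨BH.comp_trans hΓ ih.1 st.1, ?_⟩
      rw [Finset.sum_insert hi]
      have := BH.D_triangle hΓ (hf x hx) (hf _ (hz t)) hm ih.1 st.1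
      linarith [ih.2, st.2]
  have := (key Finset.univ).2
  simpa using this
end

section
/- Let C be a normal closed cone in a real Banach space, u ∈ C\{0}, and suppose φ : C_u → (0, ∞) is continuous in the norm topology and homogeneous (φ(αx) = αφ(x) for all α ≥ 0). Let S_φ = {x ∈ C_u : φ(x) = 1}. Then (S_φ, d_C) is a complete metric space, where d_C is the Hilbert projective metric. -/
/-- The component `C_u = {x ∈ C : x ∼_C u}` of `u` in the cone `C`. -/
def coneComponent {V : Type*} [AddCommGroup V] [Module ℝ V] (C : Set V) (u : V) : Set V :=
  {x ∈ C | coneComp C x u}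

/-- A cone `C` in a Banach space is normal if there is `γ > 0` with `‖x‖ ≤ γ ‖y‖` whenever
`0 ⪯_C x ⪯_C y`. -/
def IsNormalCone {V : Type*} [NormedAddCommGroup V] [NormedSpace ℝ V] (C : Set V) : Prop :=
  ∃ γ : ℝ, 0 < γ ∧ ∀ x y : V, coneLE C 0 x → coneLE C x y → ‖x‖ ≤ γ * ‖y‖


namespace HilbAux

section
variable {V : Type*} [AddCommGroup V] [Module ℝ V] {C : Set V}

lemma add_mem (hC : IsCone C) {x y : V} (hx : x ∈ C) (hy : y ∈ C) : x + y ∈ C := by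
  have h := hC.1 hx hy (by norm_num : (0:ℝ) ≤ 1/2) (by norm_num : (0:ℝ) ≤ 1/2) (by norm_num)
  have h2 := hC.2.1 _ h 2 (by norm_num)
  convert h2 using 1
  module

lemma le_trans (hC : IsCone C) {x y z : V} (h1 : coneLE C x y) (h2 : coneLE C y z) :
    coneLE C x z := by
  have h := add_mem hC h1 h2
  unfold coneLE
  convert h using 1
  abel

lemma le_smul (hC : IsCone C) {x y : V} {a : ℝ} (ha : 0 ≤ a) (h1 : coneLE C x y) :
    coneLE C (a • x) (a • y) := by
  have h := hC.2.1 _ h1 a ha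
  unfold coneLE
  rwa [← smul_sub]

lemma antisymm (hC : IsCone C) {x y : V} (h1 : coneLE C x y) (h2 : coneLE C y x) : x = y := by
  have h : y - x ∈ C ∩ (-C) := ⟨h1, by
    have : x - y ∈ C := h2
    simpa using this⟩
  rw [hC.2.2] at h
  exact (sub_eq_zero.1 h).symm

lemma le_scalar (hC : IsCone C) {y : V} (hy : y ∈ C) (hy0 : y ≠ 0) {a b : ℝ}
    (h : coneLE C (a • y) (b • y)) : a ≤ b := by
  by_contra hlt
  push Not at hlt
  have h1 : coneLE C (b • y) (a • y) := by
    have := hC.2.1 _ hy (a - b) (by linarith)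
    unfold coneLE
    rwa [← sub_smul]
  have h2 := antisymm hC h h1
  have h3 : (a - b) • y = 0 := by rw [sub_smul, h2, sub_self]
  rcases smul_eq_zero.1 h3 with h4 | h4
  · linarith
  · exact hy0 h4

lemma scalar_le (hC : IsCone C) {y : V} (hy : y ∈ C) {a b : ℝ}
    (h : a ≤ b) : coneLE C (a • y) (b • y) := by
  have := hC.2.1 _ hy (b - a) (by linarith)
  unfold coneLE
  rwa [← sub_smul]

lemma comp_ne (hC : IsCone C) {u x : V} (hu : u ∈ C) (hu0 : u ≠ 0)
    (hx : x ∈ coneComponent C u) : x ≠ 0 := by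
  rintro rfl
  obtain ⟨_, ⟨a, ha, h⟩, _⟩ := hx
  have := le_scalar hC hu hu0 (a := a) (b := 0) (by simpa using h)
  linarith

lemma comp_smul (hC : IsCone C) {u x : V}
    (hx : x ∈ coneComponent C u) {a : ℝ} (ha : 0 < a) : a • x ∈ coneComponent C u := by
  obtain ⟨h0, ⟨b, hb, h⟩, ⟨c, hc, h'⟩⟩ := hx
  refine ⟨hC.2.1 _ h0 a ha.le, ⟨a * b, by positivity, ?_⟩, ⟨a * c, by positivity, ?_⟩⟩
  · rw [mul_smul]; exact le_smul hC ha.le h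
  · rw [mul_smul]; exact le_smul hC ha.le h'

lemma comp_comp (hC : IsCone C) {u x y : V}
    (hx : x ∈ coneComponent C u) (hy : y ∈ coneComponent C u) : coneComp C x y := by
  obtain ⟨_, ⟨a, ha, h1⟩, ⟨b, hb, h2⟩⟩ := hx
  obtain ⟨_, ⟨c, hc, h3⟩, ⟨d, hd, h4⟩⟩ := hy
  refine ⟨⟨a * d⁻¹, by positivity, ?_⟩, ⟨b * c⁻¹, by positivity, ?_⟩⟩
  · refine le_trans hC ?_ h1
    have := le_smul hC (a := a * d⁻¹) (by positivity) h4
    rwa [smul_smul (a * d⁻¹) d u, mul_assoc, inv_mul_cancel₀ hd.ne', mul_one] at this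
  · refine le_trans hC h2 ?_
    have := le_smul hC (a := b * c⁻¹) (by positivity) h3
    rwa [smul_smul (b * c⁻¹) c u, mul_assoc, inv_mul_cancel₀ hc.ne', mul_one] at this

end

section
variable {V : Type*} [NormedAddCommGroup V] [NormedSpace ℝ V] {C : Set V}

lemma M_spec (hC : IsCone C) (hCcl : IsClosed C) {u x y : V} (hu : u ∈ C) (hu0 : u ≠ 0)
    (hx : x ∈ coneComponent C u) (hy : y ∈ coneComponent C u) :
    0 < coneM C x y ∧ coneLE C x (coneM C x y • y) ∧
      ∀ b, coneLE C x (b • y) → coneM C x y ≤ b := by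
  have hy0 := comp_ne hC hu hu0 hy
  obtain ⟨⟨a, ha, h1⟩, ⟨b, hb, h2⟩⟩ := comp_comp hC hx hy
  have hlow : ∀ c ∈ {β : ℝ | coneLE C x (β • y)}, a ≤ c := fun c hc =>
    le_scalar hC hy.1 hy0 (le_trans hC h1 hc)
  have hbdd : BddBelow {β : ℝ | coneLE C x (β • y)} := ⟨a, hlow⟩
  have hne : {β : ℝ | coneLE C x (β • y)}.Nonempty := ⟨b, h2⟩
  have hcl : IsClosed {β : ℝ | coneLE C x (β • y)} :=
    hCcl.preimage (f := fun β : ℝ => β • y - x) (by fun_prop)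
  exact ⟨lt_of_lt_of_le ha (le_csInf hne hlow), hcl.csInf_mem hne hbdd,
    fun c hc => csInf_le hbdd hc⟩

lemma MM_ge (hC : IsCone C) (hCcl : IsClosed C) {u x y : V} (hu : u ∈ C) (hu0 : u ≠ 0)
    (hx : x ∈ coneComponent C u) (hy : y ∈ coneComponent C u) :
    1 ≤ coneM C x y * coneM C y x := by
  obtain ⟨p1, q1, r1⟩ := M_spec hC hCcl hu hu0 hx hy
  obtain ⟨p2, q2, r2⟩ := M_spec hC hCcl hu hu0 hy hx
  have h := le_trans hC q1 (le_smul hC p1.le q2)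
  refine le_scalar hC hx.1 (comp_ne hC hu hu0 hx) ?_
  rwa [one_smul, mul_smul]

lemma D_nonneg (hC : IsCone C) (hCcl : IsClosed C) {u x y : V} (hu : u ∈ C) (hu0 : u ≠ 0)
    (hx : x ∈ coneComponent C u) (hy : y ∈ coneComponent C u) :
    0 ≤ hilbertD C x y := Real.log_nonneg (MM_ge hC hCcl hu hu0 hx hy)

lemma D_le (hC : IsCone C) (hCcl : IsClosed C) {u x y : V} (hu : u ∈ C) (hu0 : u ≠ 0)
    (hx : x ∈ coneComponent C u) (hy : y ∈ coneComponent C u) {a b : ℝ}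
    (h1 : coneLE C x (a • y)) (h2 : coneLE C y (b • x)) :
    hilbertD C x y ≤ Real.log (a * b) := by
  obtain ⟨p1, q1, r1⟩ := M_spec hC hCcl hu hu0 hx hy
  obtain ⟨p2, q2, r2⟩ := M_spec hC hCcl hu hu0 hy hx
  apply Real.log_le_log (by positivity)
  have := r1 a h1
  have := r2 b h2
  gcongr
  linarith

end

end HilbAux

open HilbAux in
/-- **Completeness of the unit slice**: for a normal closed cone `C` in a Banach space and a
continuous homogeneous `φ : C_u → (0, ∞)`, the slice `S_φ = {x ∈ C_u : φ(x) = 1}` equipped with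
the Hilbert projective metric is a complete metric space. -/
theorem slice_complete_hilbert_metric
    {V : Type*} [NormedAddCommGroup V] [NormedSpace ℝ V] [CompleteSpace V]
    (C : Set V) (hC : IsCone C) (hCcl : IsClosed C) (hCnorm : IsNormalCone C)
    (u : V) (hu : u ∈ C) (hu0 : u ≠ 0)
    (φ : V → ℝ)
    (hφpos : ∀ x ∈ coneComponent C u, 0 < φ x)
    (hφcont : ContinuousOn φ (coneComponent C u))
    (hφhom : ∀ x ∈ coneComponent C u, ∀ a : ℝ, 0 < a → φ (a • x) = a * φ x) :
    -- `d_C` is a metric on `S_φ = {x ∈ C_u : φ x = 1}` …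
    (∀ x ∈ coneComponent C u, ∀ y ∈ coneComponent C u, φ x = 1 → φ y = 1 →
      0 ≤ hilbertD C x y) ∧
    (∀ x ∈ coneComponent C u, ∀ y ∈ coneComponent C u, φ x = 1 → φ y = 1 →
      (hilbertD C x y = 0 ↔ x = y)) ∧
    (∀ x ∈ coneComponent C u, ∀ y ∈ coneComponent C u, φ x = 1 → φ y = 1 →
      hilbertD C x y = hilbertD C y x) ∧
    (∀ x ∈ coneComponent C u, ∀ y ∈ coneComponent C u, ∀ z ∈ coneComponent C u,
      φ x = 1 → φ y = 1 → φ z = 1 →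
      hilbertD C x z ≤ hilbertD C x y + hilbertD C y z) ∧
    -- … and it is complete: every `d_C`-Cauchy sequence in `S_φ` converges in `S_φ`.
    (∀ seq : ℕ → V, (∀ n, seq n ∈ coneComponent C u ∧ φ (seq n) = 1) →
      (∀ ε : ℝ, 0 < ε → ∃ N : ℕ, ∀ m ≥ N, ∀ n ≥ N, hilbertD C (seq m) (seq n) < ε) →
      ∃ l, (l ∈ coneComponent C u ∧ φ l = 1) ∧
        Filter.Tendsto (fun n => hilbertD C (seq n) l) Filter.atTop (nhds 0)) := by
  refine ⟨fun x hx y hy _ _ => D_nonneg hC hCcl hu hu0 hx hy, ?_, ?_, ?_, ?_⟩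
  · intro x hx y hy fx fy
    obtain ⟨p1, q1, r1⟩ := M_spec hC hCcl hu hu0 hx hy
    obtain ⟨p2, q2, r2⟩ := M_spec hC hCcl hu hu0 hy hx
    constructor
    · intro h
      have h1 : coneM C x y * coneM C y x = 1 :=
        Real.eq_one_of_pos_of_log_eq_zero (by positivity) h
      have h2 := le_smul hC p1.le q2
      rw [smul_smul, h1, one_smul] at h2
      have h3 := antisymm hC q1 h2
      have h4 := hφhom y hy _ p1
      rw [← h3, fx, fy, mul_one] at h4
      rw [h3, ← h4, one_smul]
    · rintro rfl
      refine le_antisymm ?_ (D_nonneg hC hCcl hu hu0 hx hx)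
      have h0 : coneLE C x ((1:ℝ) • x) := by
        simpa using scalar_le hC hx.1 (le_refl (1:ℝ))
      simpa using D_le hC hCcl hu hu0 hx hx h0 h0
  · intro x _ y _ _ _
    unfold hilbertD
    rw [mul_comm]
  · intro x hx y hy z hz _ _ _
    obtain ⟨p1, q1, -⟩ := M_spec hC hCcl hu hu0 hx hy
    obtain ⟨p2, q2, -⟩ := M_spec hC hCcl hu hu0 hy hx
    obtain ⟨p3, q3, -⟩ := M_spec hC hCcl hu hu0 hy hz
    obtain ⟨p4, q4, -⟩ := M_spec hC hCcl hu hu0 hz hy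
    have h1 := HilbAux.le_trans hC q1 (le_smul hC p1.le q3)
    have h2 := HilbAux.le_trans hC q4 (le_smul hC p4.le q2)
    rw [smul_smul] at h1 h2
    have h3 := D_le hC hCcl hu hu0 hx hz h1 h2
    unfold hilbertD at h3 ⊢
    rw [← Real.log_mul (by positivity) (by positivity)]
    convert h3 using 2
    ring
  · intro seq hseq hcau
    have huu : u ∈ coneComponent C u := by
      have h0 : coneLE C ((1:ℝ) • u) ((1:ℝ) • u) := scalar_le hC hu (le_refl (1:ℝ))
      exact ⟨hu, ⟨1, one_pos, by simpa using h0⟩, ⟨1, one_pos, by simpa using h0⟩⟩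
    obtain ⟨γ, hγ, hn⟩ := hCnorm
    -- normalise so that `M(y_n/u) = 1`
    set c : ℕ → ℝ := fun n => coneM C (seq n) u with hc
    have hcp : ∀ n, 0 < c n := fun n => (M_spec hC hCcl hu hu0 (hseq n).1 huu).1
    set y : ℕ → V := fun n => (c n)⁻¹ • seq n with hy
    have hyc : ∀ n, y n ∈ coneComponent C u := fun n =>
      comp_smul hC (hseq n).1 (inv_pos.2 (hcp n))
    have hys : ∀ n, seq n = c n • y n := fun n => by
      simp only [hy]; rw [smul_inv_smul₀ (hcp n).ne']
    have hyu : ∀ n, coneLE C (y n) u := fun n => by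
      have := le_smul hC (inv_pos.2 (hcp n)).le (M_spec hC hCcl hu hu0 (hseq n).1 huu).2.1
      rwa [inv_smul_smul₀ (hcp n).ne'] at this
    have hmin : ∀ (n : ℕ) (b : ℝ), coneLE C (y n) (b • u) → 1 ≤ b := fun n b hb => by
      have h1 := le_smul hC (hcp n).le hb
      rw [← hys, smul_smul] at h1
      have h2 := (M_spec hC hCcl hu hu0 (hseq n).1 huu).2.2 _ h1
      have h3 : c n * 1 ≤ c n * b := by simpa using h2
      exact le_of_mul_le_mul_left h3 (hcp n)
    -- the key estimate
    have hone : ∀ (m n : ℕ) (b : ℝ), 0 ≤ b → coneLE C (y m) (b • y n) → 1 ≤ b := fun m n b hb h =>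
      hmin m b (HilbAux.le_trans hC h (le_smul hC hb (hyu n)))
    have key : ∀ m n ε, hilbertD C (seq m) (seq n) < ε →
        coneLE C (y m) (Real.exp ε • y n) := by
      intro m n ε hε
      obtain ⟨p1, q1, -⟩ := M_spec hC hCcl hu hu0 (hseq m).1 (hseq n).1
      obtain ⟨p2, q2, -⟩ := M_spec hC hCcl hu hu0 (hseq n).1 (hseq m).1
      have hprod : coneM C (seq m) (seq n) * coneM C (seq n) (seq m) < Real.exp ε :=
        (Real.log_lt_iff_lt_exp (by positivity)).1 hε
      set A := coneM C (seq m) (seq n)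
      set B := coneM C (seq n) (seq m)
      have e1 : coneLE C (y m) (((c m)⁻¹ * A * c n) • y n) := by
        have := le_smul hC (inv_pos.2 (hcp m)).le q1
        rw [hys n, smul_smul, smul_smul] at this
        exact this
      have e2 : coneLE C (y n) (((c n)⁻¹ * B * c m) • y m) := by
        have := le_smul hC (inv_pos.2 (hcp n)).le q2
        rw [hys m, smul_smul, smul_smul] at this
        exact this
      have hm := hcp m
      have hn' := hcp n
      have f2 := hone n m _ (by positivity) e2
      refine HilbAux.le_trans hC e1 (scalar_le hC (hyc n).1 ?_)
      have f3 : ((c m)⁻¹ * A * c n) * ((c n)⁻¹ * B * c m) = A * B := by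
        field_simp
      have f4 : 0 ≤ (c m)⁻¹ * A * c n := by positivity
      nlinarith
    have hnorm : ∀ m n ε, hilbertD C (seq m) (seq n) < ε → hilbertD C (seq n) (seq m) < ε →
        ‖y m - y n‖ ≤ (2 * γ + 1) * ‖u‖ * (Real.exp ε - 1) := by
      intro m n ε h1 h2
      have hε : 0 < ε := lt_of_le_of_lt (D_nonneg hC hCcl hu hu0 (hseq m).1 (hseq n).1) h1
      set t := Real.exp ε - 1 with ht
      have ht0 : 0 ≤ t := by have := Real.one_le_exp hε.le; linarith
      have aux : ∀ i j, coneLE C (y i) (Real.exp ε • y j) → coneLE C (y i - y j) (t • u) := by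
        intro i j h
        have h3 := le_smul hC ht0 (hyu j)
        refine HilbAux.le_trans hC ?_ h3
        unfold coneLE at h ⊢
        convert h using 1
        rw [ht]; module
      have a1 := aux _ _ (key _ _ _ h1)
      have a2 := aux _ _ (key _ _ _ h2)
      have b := hn (y m - y n + t • u) ((2 * t) • u)
        (by unfold coneLE at a2 ⊢; convert a2 using 1; abel)
        (by unfold coneLE at a1 ⊢; convert a1 using 1; module)
      rw [norm_smul, Real.norm_of_nonneg (by positivity)] at b
      have b2 : ‖y m - y n‖ ≤ ‖y m - y n + t • u‖ + ‖t • u‖ := by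
        have := norm_sub_le (y m - y n + t • u) (t • u)
        simpa using this
      rw [norm_smul, Real.norm_of_nonneg ht0] at b2
      linarith
    have hcs : CauchySeq y := by
      rw [Metric.cauchySeq_iff]
      intro δ hδ
      have hlim : Filter.Tendsto (fun ε : ℝ => (2 * γ + 1) * ‖u‖ * (Real.exp ε - 1))
          (nhdsWithin 0 (Set.Ioi 0)) (nhds 0) := by
        have : Continuous (fun ε : ℝ => (2 * γ + 1) * ‖u‖ * (Real.exp ε - 1)) := by fun_prop
        have h := this.tendsto 0
        simp only [Real.exp_zero, sub_self, mul_zero] at h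
        exact h.mono_left nhdsWithin_le_nhds
      obtain ⟨ε, h1, h2⟩ := ((hlim.eventually (gt_mem_nhds hδ)).and
        self_mem_nhdsWithin).exists
      obtain ⟨N, hN⟩ := hcau ε h2
      refine ⟨N, fun m hm n hn' => ?_⟩
      rw [dist_eq_norm]
      exact lt_of_le_of_lt (hnorm m n ε (hN m hm n hn') (hN n hn' m hm)) h1
    obtain ⟨w, hw⟩ := cauchySeq_tendsto_of_complete hcs
    have lim1 : ∀ ε > 0, ∃ N, ∀ n ≥ N, coneLE C (y n) (Real.exp ε • w) ∧
        coneLE C w (Real.exp ε • y n) := by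
      intro ε hε
      obtain ⟨N, hN⟩ := hcau ε hε
      refine ⟨N, fun n hn' => ⟨?_, ?_⟩⟩
      · refine hCcl.mem_of_tendsto ((hw.const_smul (Real.exp ε)).sub_const (y n)) ?_
        filter_upwards [Filter.eventually_ge_atTop N] with m hm
        exact key n m ε (hN n hn' m hm)
      · refine hCcl.mem_of_tendsto (hw.const_sub (Real.exp ε • y n)) ?_
        filter_upwards [Filter.eventually_ge_atTop N] with m hm
        exact key m n ε (hN m hm n hn')
    have hwC : w ∈ C := hCcl.mem_of_tendsto hw (Filter.Eventually.of_forall fun n => (hyc n).1)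
    have hwc : w ∈ coneComponent C u := by
      obtain ⟨N, hN⟩ := lim1 1 one_pos
      obtain ⟨g1, g2⟩ := hN N le_rfl
      obtain ⟨_, ⟨a, ha, k1⟩, ⟨b, hb, k2⟩⟩ := hyc N
      have he := Real.exp_pos 1
      refine ⟨hwC, ⟨(Real.exp 1)⁻¹ * a, by positivity, ?_⟩, ⟨Real.exp 1 * b, by positivity, ?_⟩⟩
      · have := le_smul hC (inv_pos.2 he).le (HilbAux.le_trans hC k1 g1)
        rwa [inv_smul_smul₀ he.ne', smul_smul] at this
      · have := HilbAux.le_trans hC g2 (le_smul hC he.le k2)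
        rwa [smul_smul] at this
    have hp := hφpos w hwc
    have hlc : (φ w)⁻¹ • w ∈ coneComponent C u := comp_smul hC hwc (inv_pos.2 hp)
    refine ⟨(φ w)⁻¹ • w, ⟨hlc, ?_⟩, ?_⟩
    · rw [hφhom w hwc _ (inv_pos.2 hp), inv_mul_cancel₀ hp.ne']
    · rw [Metric.tendsto_atTop]
      intro ε hε
      obtain ⟨N, hN⟩ := lim1 (ε / 4) (by positivity)
      refine ⟨N, fun n hn' => ?_⟩
      obtain ⟨g1, g2⟩ := hN n hn'
      have hcn := hcp n
      have g3 : coneLE C (seq n) ((c n * Real.exp (ε / 4) * φ w) • ((φ w)⁻¹ • w)) := by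
        have := le_smul hC hcn.le g1
        rw [← hys, smul_smul] at this
        rwa [smul_smul, mul_assoc (c n * _), mul_inv_cancel₀ hp.ne', mul_one]
      have g4 : coneLE C ((φ w)⁻¹ • w) (((φ w)⁻¹ * Real.exp (ε / 4) * (c n)⁻¹) • seq n) := by
        have := le_smul hC (inv_pos.2 hp).le g2
        simp only [hy] at this
        rwa [smul_smul, smul_smul] at this
      have g5 := D_le hC hCcl hu hu0 (hseq n).1 hlc g3 g4
      have g6 : (c n * Real.exp (ε / 4) * φ w) * ((φ w)⁻¹ * Real.exp (ε / 4) * (c n)⁻¹)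
          = Real.exp (ε / 4 + ε / 4) := by
        rw [Real.exp_add]; field_simp
      rw [g6, Real.log_exp] at g5
      rw [Real.dist_eq, sub_zero, abs_of_nonneg (D_nonneg hC hCcl hu hu0 (hseq n).1 hlc)]
      linarith
end

section
/- Let f : ℝ^n → ℝ^n be a linear map that is positive, i.e. f(ℝ^n_+ \ {0}) ⊆ ℝ^n_{++}. Then f is a strict contraction in the Hilbert metric on the positive orthant: there exists a constant 0 ≤ c < 1 such that d(f(x), f(y)) ≤ c · d(x, y) for all x, y ∈ ℝ^n_{++}, where d(x, y) = log( max_i (x_i / y_i) · max_j (y_j / x_j) ). -/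
/-- The Hilbert projective metric on the interior of the positive orthant of `ℝⁿ`:
`d(x, y) = log (max_i (x_i / y_i) * max_j (y_j / x_j))`. -/
noncomputable def orthantD {n : ℕ} (x y : Fin n → ℝ) : ℝ :=
  Real.log ((⨆ i, x i / y i) * (⨆ j, y j / x j))

/-- Rows of the matrix of a positive map are uniformly comparable. -/
theorem exists_row_comparison {n : ℕ} (hn : 0 < n) (f : (Fin n → ℝ) →ₗ[ℝ] (Fin n → ℝ))
    (hf : ∀ x : Fin n → ℝ, (∀ i, 0 ≤ x i) → x ≠ 0 → ∀ i, 0 < f x i) :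
    ∃ e : ℝ, 0 < e ∧ e ≤ 1 ∧ ∀ z : Fin n → ℝ, (∀ i, 0 ≤ z i) → ∀ i k, e * f z k ≤ f z i := by
  have : Nonempty (Fin n) := ⟨⟨0, hn⟩⟩
  set a : Fin n → Fin n → ℝ := fun i j => f (fun l => if j = l then 1 else 0) i with ha
  have hpos : ∀ i j, 0 < a i j := by
    intro i j
    apply hf
    · intro l
      split_ifs <;> norm_num
    · intro h
      have := congrFun h j
      simp at this
  obtain ⟨p, hp⟩ := Finite.exists_min
    (fun q : Fin n × Fin n × Fin n => a q.1 q.2.2 / a q.2.1 q.2.2)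
  refine ⟨a p.1 p.2.2 / a p.2.1 p.2.2, div_pos (hpos _ _) (hpos _ _), ?_, ?_⟩
  · have := hp (p.1, p.1, p.2.2)
    simp only [div_self (hpos _ _).ne'] at this
    exact this
  · intro z hz i k
    have hsum : ∀ i, f z i = ∑ j, z j * a i j := by
      intro i
      rw [LinearMap.pi_apply_eq_sum_univ f z]
      simp [ha, Finset.sum_apply]
    rw [hsum, hsum, Finset.mul_sum]
    refine Finset.sum_le_sum fun j _ => ?_
    have h := hp (i, k, j)
    simp only at h
    rw [le_div_iff₀ (hpos _ _)] at h
    have := mul_le_mul_of_nonneg_left h (hz j)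
    linarith

/-- **Positive linear maps are strict Hilbert-metric contractions**: a linear map
`f : ℝⁿ → ℝⁿ` with `f(ℝⁿ₊ \ {0}) ⊆ ℝⁿ₊₊` contracts the Hilbert metric on `ℝⁿ₊₊` with some
ratio `c < 1`. -/
theorem positive_linear_map_strict_contraction
    {n : ℕ} (hn : 0 < n) (f : (Fin n → ℝ) →ₗ[ℝ] (Fin n → ℝ))
    (hf : ∀ x : Fin n → ℝ, (∀ i, 0 ≤ x i) → x ≠ 0 → ∀ i, 0 < f x i) :
    ∃ c : ℝ, 0 ≤ c ∧ c < 1 ∧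
      ∀ x y : Fin n → ℝ, (∀ i, 0 < x i) → (∀ i, 0 < y i) →
        orthantD (f x) (f y) ≤ c * orthantD x y := by
  have : Nonempty (Fin n) := ⟨⟨0, hn⟩⟩
  obtain ⟨e, he0, he1, he⟩ := exists_row_comparison hn f hf
  have hd0 : 0 < e * e := mul_pos he0 he0
  have hd1 : e * e ≤ 1 := by nlinarith
  refine ⟨1 - e * e, by linarith, by linarith, ?_⟩
  intro x y hx hy
  have hX : ∀ i, 0 < f x i := hf x (fun i => (hx i).le)
    (fun h => (hx ⟨0, hn⟩).ne' (congrFun h _))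
  have hY : ∀ i, 0 < f y i := hf y (fun i => (hy i).le)
    (fun h => (hy ⟨0, hn⟩).ne' (congrFun h _))
  unfold orthantD
  obtain ⟨k, hk⟩ := exists_eq_ciSup_of_finite (f := fun i => f x i / f y i)
  obtain ⟨i, hi⟩ := exists_eq_ciSup_of_finite (f := fun i => f y i / f x i)
  rw [← hk, ← hi]
  have hB : ∀ j, x j / y j ≤ ⨆ i, x i / y i :=
    fun j => le_ciSup (f := fun i => x i / y i) (Set.finite_range _).bddAbove j
  have hC : ∀ j, y j / x j ≤ ⨆ i, y i / x i :=
    fun j => le_ciSup (f := fun i => y i / x i) (Set.finite_range _).bddAbove j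
  generalize (⨆ i, x i / y i) = B at hB
  generalize (⨆ i, y i / x i) = C at hC
  have hC0 : 0 < C := (div_pos (hy i) (hx i)).trans_le (hC i)
  have hB0 : 0 < B := (div_pos (hx i) (hy i)).trans_le (hB i)
  have hu : ∀ j, 0 ≤ (C • x - y) j := by
    intro j
    have := hC j
    rw [div_le_iff₀ (hx j)] at this
    simpa using this
  have hv : ∀ j, 0 ≤ (B • y - x) j := by
    intro j
    have := hB j
    rw [div_le_iff₀ (hy j)] at this
    simpa using this
  have h1 : ∀ i, f (C • x - y) i = C * f x i - f y i := by intro i; simp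
  have h2 : ∀ i, f (B • y - x) i = B * f y i - f x i := by intro i; simp
  have nonneg : ∀ z : Fin n → ℝ, (∀ i, 0 ≤ z i) → ∀ i, 0 ≤ f z i := by
    intro z hz i
    by_cases h : z = 0
    · simp [h]
    · exact (hf z hz h i).le
  have e1 := he _ hu i k
  have e2 := he y (fun i => (hy i).le) k i
  have n1 := nonneg _ hu k
  have n2 := nonneg _ hv k
  rw [h1] at n1
  rw [h1, h1] at e1
  rw [h2] at n2
  have Xi := hX i
  have Xk := hX k
  have Yi := hY i
  have Yk := hY k
  generalize f x i = a at *
  generalize f x k = b at *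
  generalize f y i = p at *
  generalize f y k = q at *
  have key : e * e * (C * b / q) + (1 - e * e) ≤ C * a / p := by
    have h3 : (e * (C * b - q)) * (e * p) ≤ (C * a - p) * q :=
      mul_le_mul e1 e2 (by positivity) ((mul_nonneg he0.le n1).trans e1)
    have h4 : C * a / p - (e * e * (C * b / q) + (1 - e * e))
        = ((C * a - p) * q - (e * (C * b - q)) * (e * p)) / (p * q) := by
      field_simp
      ring
    have : 0 ≤ C * a / p - (e * e * (C * b / q) + (1 - e * e)) := by
      rw [h4]
      exact div_nonneg (by linarith) (by positivity)
    linarith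
  have ht : 0 < C * b / q := by positivity
  have hs : 0 < C * a / p := by positivity
  have am := Real.geom_mean_le_arith_mean2_weighted hd0.le (sub_nonneg.2 hd1) ht.le
    zero_le_one (by ring)
  rw [Real.one_rpow, mul_one, mul_one] at am
  have l1 := Real.log_le_log (Real.rpow_pos_of_pos ht _) (am.trans key)
  rw [Real.log_rpow ht] at l1
  have l2 : Real.log (C * b / q) ≤ Real.log (B * C) := by
    apply Real.log_le_log ht
    rw [div_le_iff₀ Yk]
    nlinarith
  have l3 : b / q * (p / a) = (C * b / q) / (C * a / p) := by field_simp
  rw [l3, Real.log_div ht.ne' hs.ne']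
  have := mul_le_mul_of_nonneg_left l2 (sub_nonneg.2 hd1)
  linarith
end

section
/- Let f : ℝ^n → ℝ^n be a linear map that is positive, i.e. f(ℝ^n_+ \ {0}) ⊆ ℝ^n_{++}, and let e_1, …, e_n be the canonical basis of ℝ^n. Then the projective diameter of the image of the positive orthant satisfies diam(f(ℝ^n_+); ℝ^n_+) = max_{i,j,k,l} log( (⟨e_i, f(e_j)⟩ · ⟨e_k, f(e_l)⟩) / (⟨e_i, f(e_l)⟩ · ⟨e_k, f(e_j)⟩) ); in particular diam(f(ℝ^n_+); ℝ^n_+) is finite. -/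
/-- Comparability in the orthant: `α y ≤ x ≤ β y` entrywise for some `α, β > 0`. -/
def orthantComp {n : ℕ} (x y : Fin n → ℝ) : Prop :=
  ∃ α β : ℝ, 0 < α ∧ 0 < β ∧ ∀ i, α * y i ≤ x i ∧ x i ≤ β * y i

/-- The projective diameter of `S ⊆ ℝⁿ₊` with respect to the Hilbert metric (possibly `+∞`). -/
noncomputable def orthantDiam {n : ℕ} (S : Set (Fin n → ℝ)) : EReal :=
  sSup {r : EReal | ∃ x ∈ S, ∃ y ∈ S, orthantComp x y ∧ r = ((orthantD x y : ℝ) : EReal)}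

theorem orthant_comp_of_pos {n : ℕ} (hn : 0 < n) (x y : Fin n → ℝ)
    (hx : ∀ i, 0 < x i) (hy : ∀ i, 0 < y i) : orthantComp x y := by
  haveI : Nonempty (Fin n) := ⟨⟨0, hn⟩⟩
  obtain ⟨a, ha⟩ := Finite.exists_min (fun i => x i / y i)
  obtain ⟨b, hb⟩ := Finite.exists_max (fun i => x i / y i)
  refine ⟨x a / y a, x b / y b, div_pos (hx a) (hy a), div_pos (hx b) (hy b), fun i => ⟨?_, ?_⟩⟩
  · exact (le_div_iff₀ (hy i)).1 (ha i)
  · exact (div_le_iff₀ (hy i)).1 (hb i)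

theorem orthant_apply_eq_sum {n : ℕ} (f : (Fin n → ℝ) →ₗ[ℝ] (Fin n → ℝ)) (u : Fin n → ℝ)
    (i : Fin n) : f u i = ∑ j, u j * f (Pi.single j 1) i := by
  have h := LinearMap.pi_apply_eq_sum_univ f u
  have h2 := congrFun h i
  rw [h2, Finset.sum_apply]
  refine Finset.sum_congr rfl fun j _ => ?_
  have : (fun k => if j = k then (1 : ℝ) else 0) = Pi.single j 1 := by
    ext k
    simp [Pi.single_apply, eq_comm]
  simp [this]

theorem projective_diameter_positive_linear_map
    {n : ℕ} (hn : 0 < n) (f : (Fin n → ℝ) →ₗ[ℝ] (Fin n → ℝ))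
    (hf : ∀ x : Fin n → ℝ, (∀ i, 0 ≤ x i) → x ≠ 0 → ∀ i, 0 < f x i) :
    orthantDiam (f '' {x : Fin n → ℝ | ∀ i, 0 ≤ x i})
      = ((⨆ i, ⨆ j, ⨆ k, ⨆ l,
          Real.log ((f (Pi.single j 1) i * f (Pi.single l 1) k) /
            (f (Pi.single l 1) i * f (Pi.single j 1) k)) : ℝ) : EReal) := by
  haveI : Nonempty (Fin n) := ⟨⟨0, hn⟩⟩
  have hnn : ∀ j : Fin n, ∀ i, 0 ≤ (Pi.single j 1 : Fin n → ℝ) i := by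
    intro j i
    by_cases h : i = j
    · subst h; simp
    · simp [h]
  have hA : ∀ j i, 0 < f (Pi.single j 1) i := by
    intro j i
    exact hf _ (hnn j) (by simp) i
  set F : Fin n → Fin n → Fin n → Fin n → ℝ := fun i j k l =>
    Real.log ((f (Pi.single j 1) i * f (Pi.single l 1) k) /
            (f (Pi.single l 1) i * f (Pi.single j 1) k)) with hF
  have hle : ∀ i j k l, F i j k l ≤ ⨆ i, ⨆ j, ⨆ k, ⨆ l, F i j k l := by
    intro i j k l
    refine le_trans ?_ (le_ciSup (Set.finite_range _).bddAbove i)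
    refine le_trans ?_ (le_ciSup (Set.finite_range _).bddAbove j)
    refine le_trans ?_ (le_ciSup (Set.finite_range _).bddAbove k)
    exact le_ciSup (Set.finite_range (fun l => F i j k l)).bddAbove l
  have hatt : ∃ i j k l, F i j k l = ⨆ i, ⨆ j, ⨆ k, ⨆ l, F i j k l := by
    obtain ⟨i, hi⟩ := exists_eq_ciSup_of_finite (f := fun i => ⨆ j, ⨆ k, ⨆ l, F i j k l)
    obtain ⟨j, hj⟩ := exists_eq_ciSup_of_finite (f := fun j => ⨆ k, ⨆ l, F i j k l)
    obtain ⟨k, hk⟩ := exists_eq_ciSup_of_finite (f := fun k => ⨆ l, F i j k l)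
    obtain ⟨l, hl⟩ := exists_eq_ciSup_of_finite (f := fun l => F i j k l)
    exact ⟨i, j, k, l, hl.trans (hk.trans (hj.trans hi))⟩
  change orthantDiam _ = ((⨆ i, ⨆ j, ⨆ k, ⨆ l, F i j k l : ℝ) : EReal)
  generalize (⨆ i, ⨆ j, ⨆ k, ⨆ l, F i j k l) = M at hle hatt
  have hM0 : 0 ≤ M := by
    let a : Fin n := ⟨0, hn⟩
    refine le_trans (le_of_eq ?_) (hle a a a a)
    have := (hA a a).ne'
    simp [hF]
  apply le_antisymm
  · apply sSup_le
    rintro r ⟨_, ⟨u, hu, rfl⟩, _, ⟨v, hv, rfl⟩, -, rfl⟩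
    rw [EReal.coe_le_coe_iff]
    by_cases hu0 : u = 0
    · simp [hu0, orthantD, hM0]
    by_cases hv0 : v = 0
    · simp [hv0, orthantD, hM0]
    have hx := hf u hu hu0
    have hy := hf v hv hv0
    unfold orthantD
    obtain ⟨i, hi⟩ := exists_eq_ciSup_of_finite (f := fun i => f u i / f v i)
    obtain ⟨k, hk⟩ := exists_eq_ciSup_of_finite (f := fun k => f v k / f u k)
    rw [← hi, ← hk]
    have p1 := hx i
    have p2 := hx k
    have p3 := hy i
    have p4 := hy k
    rw [Real.log_le_iff_le_exp (by positivity), div_mul_div_comm, div_le_iff₀ (by positivity)]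
    rw [mul_comm (f v i), orthant_apply_eq_sum f u i, orthant_apply_eq_sum f v k,
      orthant_apply_eq_sum f v i, orthant_apply_eq_sum f u k, Finset.sum_mul_sum,
      Finset.sum_mul_sum, Finset.mul_sum]
    refine Finset.sum_le_sum fun j _ => ?_
    rw [Finset.mul_sum]
    refine Finset.sum_le_sum fun l _ => ?_
    have h := hle i j k l
    have q1 := hA j i
    have q2 := hA l k
    have q3 := hA l i
    have q4 := hA j k
    rw [hF] at h
    simp only at h
    rw [Real.log_le_iff_le_exp (by positivity), div_le_iff₀ (by positivity)] at h
    have := mul_le_mul_of_nonneg_left h (mul_nonneg (hu j) (hv l))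
    linarith
  · obtain ⟨i, j, k, l, h⟩ := hatt
    refine le_trans ?_ (le_sSup ⟨f (Pi.single j 1), ⟨_, hnn j, rfl⟩, f (Pi.single l 1),
      ⟨_, hnn l, rfl⟩, orthant_comp_of_pos hn _ _ (hA j) (hA l), rfl⟩)
    rw [EReal.coe_le_coe_iff, ← h]
    have q1 := hA j i
    have q2 := hA l k
    have q3 := hA l i
    have q4 := hA j k
    simp only [hF, orthantD]
    apply Real.log_le_log (by positivity)
    rw [← div_mul_div_comm]
    have r1 := le_ciSup (Set.finite_range
      (fun i => f (Pi.single j 1) i / f (Pi.single l 1) i)).bddAbove i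
    have r2 := le_ciSup (Set.finite_range
      (fun i => f (Pi.single l 1) i / f (Pi.single j 1) i)).bddAbove k
    have r0 : 0 < f (Pi.single j 1) i / f (Pi.single l 1) i := by positivity
    exact mul_le_mul r1 r2 (by positivity) (r0.le.trans r1)
end

section
/- In the setting of the integral operators f_i with all exponents α_{ij} = 1, fix i ≠ j in {1, …, ν}. For every z ∈ 𝒞 and all x_j, y_j ∈ C_j, the functions f_i|_z^j(x_j) and f_i|_z^j(y_j) obtained by replacing the j-th argument of f_i (with the other arguments frozen at z) satisfy d_{C_i}( f_i|_z^j(x_j), f_i|_z^j(y_j) ) ≤ log △_j(K), where △_j(K) is the kernel cross-ratio and d_{C_i} is the Hilbert projective metric on the cone of nonnegative continuous functions on X_i. -/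
open MeasureTheory

/-- Extend a point of `∏_{j ≠ i} X j` to a point of `∏_j X j` by inserting `ξ` in slot `i`. -/
noncomputable def insertAt {ν : ℕ} (X : Fin ν → Type*) (i : Fin ν) (ξ : X i)
    (ω : ∀ j : {j : Fin ν // j ≠ i}, X j.1) (j : Fin ν) : X j :=
  if h : j = i then cast (congrArg X h).symm ξ else ω ⟨j, h⟩

/-- The integral operator
`f_i(x)(ξ_i) = ∫_{Ω_i} K(ξ_1, …, ξ_ν) ∏_{j ≠ i} x_j(ξ_j) ∏_{j ≠ i} dη_j(ξ_j)`. -/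
noncomputable def intOp {ν : ℕ} {X : Fin ν → Type*} [∀ j, TopologicalSpace (X j)]
    [∀ j, MeasurableSpace (X j)]
    (K : (∀ j, X j) → ℝ) (η : ∀ j, Measure (X j)) [∀ j, SigmaFinite (η j)] (i : Fin ν)
    (x : ∀ j, C(X j, ℝ)) (ξ : X i) : ℝ :=
  ∫ ω : ∀ j : {j : Fin ν // j ≠ i}, X j.1,
    K (insertAt X i ξ ω) * ∏ j : {j : Fin ν // j ≠ i}, (x j.1) (ω j)
    ∂(Measure.pi fun j : {j : Fin ν // j ≠ i} => η j.1)

/-- The integral operator with real exponents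
`f_i(x)(ξ_i) = ∫_{Ω_i} K(ξ_1, …, ξ_ν) ∏_{j ≠ i} x_j(ξ_j)^{α_j} ∏_{j ≠ i} dη_j(ξ_j)`. -/
noncomputable def intOpPow {ν : ℕ} {X : Fin ν → Type*} [∀ j, TopologicalSpace (X j)]
    [∀ j, MeasurableSpace (X j)]
    (K : (∀ j, X j) → ℝ) (η : ∀ j, Measure (X j)) [∀ j, SigmaFinite (η j)]
    (α : Fin ν → ℝ) (i : Fin ν)
    (x : ∀ j, C(X j, ℝ)) (ξ : X i) : ℝ :=
  ∫ ω : ∀ j : {j : Fin ν // j ≠ i}, X j.1,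
    K (insertAt X i ξ ω) * ∏ j : {j : Fin ν // j ≠ i}, Real.rpow ((x j.1) (ω j)) (α j.1)
    ∂(Measure.pi fun j : {j : Fin ν // j ≠ i} => η j.1)

/-- The mode-`j` kernel cross-ratio `△_j(K)`. -/
noncomputable def crossRatio {ν : ℕ} {X : Fin ν → Type*} (K : (∀ j, X j) → ℝ) (j : Fin ν) : ℝ :=
  sSup {r : ℝ | ∃ ξ ξ' : ∀ l, X l,
    r = K ξ * K ξ' / (K (Function.update ξ j (ξ' j)) * K (Function.update ξ' j (ξ j)))}

/-- `M(x/y) = inf {β : x(ξ) ≤ β y(ξ) for all ξ}` for real-valued functions. -/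
noncomputable def funM {X : Type*} (x y : X → ℝ) : ℝ :=
  sInf {β : ℝ | ∀ ξ, x ξ ≤ β * y ξ}

/-- The Hilbert projective metric `d(x,y) = log (M(x/y) M(y/x))` on the cone of nonnegative
functions. -/
noncomputable def funD {X : Type*} (x y : X → ℝ) : ℝ :=
  Real.log (funM x y * funM y x)

lemma aux_funD {X : Type*} [Nonempty X] (F G : X → ℝ) (D : ℝ) (hD : 1 ≤ D)
    (hF : (∀ ξ, F ξ = 0) ∨ ∀ ξ, 0 < F ξ) (hG : (∀ ξ, G ξ = 0) ∨ ∀ ξ, 0 < G ξ)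
    (h : ∀ ξ ξ', F ξ * G ξ' ≤ D * (G ξ * F ξ')) :
    funD F G ≤ Real.log D := by
  have hzero : ∀ F G : X → ℝ, (∀ ξ, F ξ = 0) → ((∀ ξ, G ξ = 0) ∨ ∀ ξ, 0 < G ξ) →
      funM F G = 0 := by
    intro F G hF hG
    unfold funM
    obtain ⟨ξ0⟩ := ‹Nonempty X›
    rcases hG with hG | hG
    · have : {β : ℝ | ∀ ξ, F ξ ≤ β * G ξ} = Set.univ := by
        ext β; simp [hF, hG]
      rw [this, Real.sInf_univ]
    · have : {β : ℝ | ∀ ξ, F ξ ≤ β * G ξ} = Set.Ici 0 := by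
        ext β
        simp only [hF, Set.mem_ofPred_eq, Set.mem_Ici]
        constructor
        · intro h
          exact nonneg_of_mul_nonneg_left (h ξ0) (hG ξ0)
        · intro h ξ
          exact mul_nonneg h (hG ξ).le
      rw [this, csInf_Ici]
  unfold funD
  rcases hF with hF | hF
  · rw [hzero F G hF hG, zero_mul, Real.log_zero]
    exact Real.log_nonneg hD
  rcases hG with hG | hG
  · rw [hzero G F hG (Or.inr hF), mul_zero, Real.log_zero]
    exact Real.log_nonneg hD
  obtain ⟨ξ0⟩ := ‹Nonempty X›
  have hD0 : 0 < D := by linarith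
  have hbdd : ∀ F G : X → ℝ, (∀ ξ, 0 < G ξ) → F ξ0 / G ξ0 ∈
      lowerBounds {β : ℝ | ∀ ξ, F ξ ≤ β * G ξ} := by
    intro F G hG β hβ
    rw [div_le_iff₀ (hG ξ0)]
    exact hβ ξ0
  have hmem : ∀ ξ', D * F ξ' / G ξ' ∈ {β : ℝ | ∀ ξ, F ξ ≤ β * G ξ} := by
    intro ξ' ξ
    rw [div_mul_eq_mul_div, le_div_iff₀ (hG ξ')]
    have := h ξ ξ'
    nlinarith
  have hM : ∀ ξ', funM F G ≤ D * F ξ' / G ξ' := fun ξ' =>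
    csInf_le ⟨_, hbdd F G hG⟩ (hmem ξ')
  have hMpos : 0 < funM F G :=
    lt_of_lt_of_le (div_pos (hF ξ0) (hG ξ0)) (le_csInf ⟨_, hmem ξ0⟩ (hbdd F G hG))
  have hmem2 : D / funM F G ∈ {β : ℝ | ∀ ξ, G ξ ≤ β * F ξ} := by
    intro ξ
    have := hM ξ
    rw [le_div_iff₀ (hG ξ)] at this
    rw [div_mul_eq_mul_div, le_div_iff₀ hMpos]
    linarith
  have hM2 : funM G F ≤ D / funM F G := csInf_le ⟨_, hbdd G F hF⟩ hmem2
  have hMpos2 : 0 < funM G F :=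
    lt_of_lt_of_le (div_pos (hG ξ0) (hF ξ0)) (le_csInf ⟨_, hmem2⟩ (hbdd G F hF))
  apply Real.log_le_log (mul_pos hMpos hMpos2)
  rw [le_div_iff₀ hMpos] at hM2
  linarith

/-- Continuous functions on a finite product of compact Hausdorff spaces are measurable
for the product sigma-algebra. -/
lemma aux_meas {ι : Type*} {Y : ι → Type*} [∀ l, TopologicalSpace (Y l)]
    [∀ l, CompactSpace (Y l)] [∀ l, T2Space (Y l)] [∀ l, MeasurableSpace (Y l)]
    [∀ l, BorelSpace (Y l)] (f : (∀ l, Y l) → ℝ) (hf : Continuous f) : Measurable f := by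
  let A : Subalgebra ℝ C((∀ l, Y l), ℝ) :=
    { carrier := {g | Measurable g}
      mul_mem' := fun {a b} ha hb => by
        simp only [Set.mem_ofPred_eq, ContinuousMap.coe_mul] at *
        exact ha.mul hb
      add_mem' := fun {a b} ha hb => by
        simp only [Set.mem_ofPred_eq, ContinuousMap.coe_add] at *
        exact ha.add hb
      algebraMap_mem' := fun r => by
        change Measurable (fun _ => _)
        exact measurable_const }
  have hA : A.SeparatesPoints := by
    intro a b hab
    obtain ⟨l, hl⟩ := Function.ne_iff.mp hab
    obtain ⟨g, h0, h1, -⟩ := exists_continuous_zero_one_of_isClosed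
      (isClosed_singleton (x := a l)) (isClosed_singleton (x := b l)) (by simpa using hl)
    refine ⟨_, ⟨g.comp ⟨fun ω => ω l, continuous_apply l⟩, ?_, rfl⟩, ?_⟩
    · change Measurable (fun ω : ∀ l, Y l => g (ω l))
      exact g.continuous.measurable.comp (measurable_pi_apply l)
    · have e0 : g (a l) = 0 := h0 rfl
      have e1 : g (b l) = 1 := h1 rfl
      simp [e0, e1]
  have htop := ContinuousMap.subalgebra_topologicalClosure_eq_top_of_separatesPoints A hA
  have hfm : (⟨f, hf⟩ : C((∀ l, Y l), ℝ)) ∈ A.topologicalClosure := by rw [htop]; trivial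
  have hfc : (⟨f, hf⟩ : C((∀ l, Y l), ℝ)) ∈ closure (A : Set C((∀ l, Y l), ℝ)) := hfm
  obtain ⟨u, hu, hlim⟩ := mem_closure_iff_seq_limit.mp hfc
  refine measurable_of_tendsto_metrizable (f := fun n => ⇑(u n)) (fun n => hu n) ?_
  rw [tendsto_pi_nhds]
  intro ω
  exact ((ContinuousEvalConst.continuous_eval_const (F := C((∀ l, Y l), ℝ)) ω).tendsto _).comp hlim

open scoped ENNReal in
lemma aux_prod {A B : Type*} [MeasurableSpace A] [MeasurableSpace B] (a : Measure A)
    (b : Measure B) [SFinite a] [SFinite b] (p q : A × B → ℝ≥0∞) (u v : A → ℝ≥0∞)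
    (hp : Measurable p) (hq : Measurable q) (hu : Measurable u) (hv : Measurable v) (D : ℝ≥0∞)
    (h : ∀ s t r r', p (s, r) * q (t, r') ≤ D * (p (t, r) * q (s, r'))) :
    (∫⁻ c, p c * u c.1 ∂(a.prod b)) * (∫⁻ c, q c * v c.1 ∂(a.prod b)) ≤
      D * ((∫⁻ c, p c * v c.1 ∂(a.prod b)) * (∫⁻ c, q c * u c.1 ∂(a.prod b))) := by
  have key : ∀ (p : A × B → ℝ≥0∞) (u : A → ℝ≥0∞), Measurable p → Measurable u →
      ∫⁻ c, p c * u c.1 ∂(a.prod b) = ∫⁻ s, (∫⁻ r, p (s, r) ∂b) * u s ∂a := by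
    intro p u hp hu
    rw [lintegral_prod _ (by fun_prop)]
    refine lintegral_congr fun s => ?_
    exact lintegral_mul_const (u s) (f := fun r => p (s, r)) (by fun_prop)
  have hP : Measurable fun s => ∫⁻ r, p (s, r) ∂b := hp.lintegral_prod_right'
  have hQ : Measurable fun s => ∫⁻ r, q (s, r) ∂b := hq.lintegral_prod_right'
  have hPQ : ∀ s t, (∫⁻ r, p (s, r) ∂b) * (∫⁻ r, q (t, r) ∂b) ≤
      D * ((∫⁻ r, p (t, r) ∂b) * (∫⁻ r, q (s, r) ∂b)) := by
    intro s t
    rw [← lintegral_lintegral_mul (by fun_prop) (by fun_prop),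
      ← lintegral_prod_mul (by fun_prop) (by fun_prop), ← lintegral_const_mul _ (by fun_prop),
      lintegral_lintegral (f := fun x y => p (s, x) * q (t, y)) (by fun_prop)]
    exact lintegral_mono fun c => h s t c.1 c.2
  rw [key p u hp hu, key q v hq hv, key p v hp hv, key q u hq hu]
  rw [← lintegral_prod_mul (by fun_prop) (by fun_prop), mul_comm (∫⁻ s, _ * v s ∂a),
    ← lintegral_prod_mul (by fun_prop) (by fun_prop), ← lintegral_const_mul _ (by fun_prop)]
  refine lintegral_mono fun c => ?_
  calc _ = ((∫⁻ r, p (c.1, r) ∂b) * (∫⁻ r, q (c.2, r) ∂b)) * (u c.1 * v c.2) := by ring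
    _ ≤ (D * ((∫⁻ r, p (c.2, r) ∂b) * (∫⁻ r, q (c.1, r) ∂b))) * (u c.1 * v c.2) := by
        exact mul_le_mul_left (hPQ _ _) _
    _ = _ := by ring

lemma aux_cross {ν : ℕ} {X : Fin ν → Type*} [∀ l, TopologicalSpace (X l)]
    [∀ l, CompactSpace (X l)] (K : (∀ l, X l) → ℝ) (hKc : Continuous K) (hKpos : ∀ ξ, 0 < K ξ)
    (j : Fin ν) (ξ ξ' : ∀ l, X l) :
    K ξ * K ξ' / (K (Function.update ξ j (ξ' j)) * K (Function.update ξ' j (ξ j)))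
      ≤ crossRatio K j := by
  refine le_csSup ?_ ⟨ξ, ξ', rfl⟩
  have hc : Continuous fun c : (∀ l, X l) × (∀ l, X l) =>
      K c.1 * K c.2 / (K (Function.update c.1 j (c.2 j)) * K (Function.update c.2 j (c.1 j))) := by
    refine Continuous.div (by fun_prop) ?_ fun c => (mul_pos (hKpos _) (hKpos _)).ne'
    refine (hKc.comp ?_).mul (hKc.comp ?_)
    · exact continuous_fst.update j (by fun_prop)
    · exact continuous_snd.update j (by fun_prop)
  obtain ⟨M, hM⟩ := (isCompact_range hc).bddAbove
  refine ⟨M, ?_⟩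
  rintro r ⟨a, b, rfl⟩
  exact hM ⟨(a, b), rfl⟩

/-- **Diameter bound for positive integral operators**: freezing all but the `j`-th argument of
`f_i`, the Hilbert distance of any two images is at most `log △_j(K)`. -/
theorem integral_operator_diameter_bound
    {ν : ℕ} {X : Fin ν → Type*} [∀ l, TopologicalSpace (X l)] [∀ l, CompactSpace (X l)]
    [∀ l, T2Space (X l)] [∀ l, Nonempty (X l)]
    [∀ l, MeasurableSpace (X l)] [∀ l, BorelSpace (X l)]
    (η : ∀ l, Measure (X l)) [∀ l, IsFiniteMeasure (η l)] [∀ l, (η l).Regular]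
    [∀ l, (η l).IsOpenPosMeasure]
    (K : (∀ l, X l) → ℝ) (hKc : Continuous K) (hKpos : ∀ ξ, 0 < K ξ)
    (i j : Fin ν) (hij : i ≠ j)
    (z : ∀ l, C(X l, ℝ)) (hz : ∀ l, ∀ ξ : X l, 0 ≤ z l ξ)
    (x y : C(X j, ℝ)) (hx : ∀ ξ, 0 ≤ x ξ) (hy : ∀ ξ, 0 ≤ y ξ) :
    funD (intOp K η i (Function.update z j x)) (intOp K η i (Function.update z j y))
      ≤ Real.log (crossRatio K j) := by
  have hcr := aux_cross K hKc hKpos j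
  have hD1 : 1 ≤ crossRatio K j := by
    obtain ⟨ξ⟩ : Nonempty (∀ l, X l) := inferInstance
    have := hcr ξ ξ
    simpa [(hKpos ξ).ne'] using this
  set D := crossRatio K j with hDdef
  have hswap : ∀ ξ ξ' : ∀ l, X l, K ξ * K ξ' ≤
      D * (K (Function.update ξ j (ξ' j)) * K (Function.update ξ' j (ξ j))) := by
    intro ξ ξ'
    have := hcr ξ ξ'
    rwa [div_le_iff₀ (mul_pos (hKpos _) (hKpos _))] at this
  -- continuity and measurability of the integrands
  have hins : ∀ ξ : X i, Continuous (insertAt X i ξ) := by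
    intro ξ
    refine continuous_pi fun l => ?_
    unfold insertAt
    by_cases h : l = i
    · simp only [h, dite_true]; subst h; exact continuous_const
    · simp only [h, dite_false]; exact continuous_apply _
  let μ : Measure (∀ l : {l : Fin ν // l ≠ i}, X l.1) :=
    Measure.pi fun l : {l : Fin ν // l ≠ i} => η l.1
  have hcont : ∀ (ξ : X i) (x' : ∀ l, C(X l, ℝ)),
      Continuous fun ω : ∀ l : {l : Fin ν // l ≠ i}, X l.1 =>
        K (insertAt X i ξ ω) * ∏ l : {l : Fin ν // l ≠ i}, (x' l.1) (ω l) := by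
    intro ξ x'
    have := hins ξ
    fun_prop
  have hint : ∀ f : (∀ l : {l : Fin ν // l ≠ i}, X l.1) → ℝ, Continuous f → Integrable f μ := by
    intro f hf
    obtain ⟨C, hC⟩ := (isCompact_range hf.norm).bddAbove
    exact Integrable.of_bound (aux_meas f hf).aestronglyMeasurable C
      (Filter.Eventually.of_forall fun ω => hC ⟨ω, rfl⟩)
  have hdich : ∀ x' : ∀ l, C(X l, ℝ), (∀ l, ∀ ξ, 0 ≤ x' l ξ) →
      ((∀ ξ, intOp K η i x' ξ = 0) ∨ ∀ ξ, 0 < intOp K η i x' ξ) := by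
    intro x' hx'
    have hnn : ∀ (ξ : X i), ∀ ω : ∀ l : {l : Fin ν // l ≠ i}, X l.1,
        0 ≤ K (insertAt X i ξ ω) * ∏ l : {l : Fin ν // l ≠ i}, (x' l.1) (ω l) :=
      fun ξ ω => mul_nonneg (hKpos _).le (Finset.prod_nonneg fun l _ => hx' _ _)
    by_cases h : ∃ ξ, intOp K η i x' ξ = 0
    · left
      obtain ⟨ξ, hξ⟩ := h
      intro ξ'
      unfold intOp at hξ ⊢
      rw [integral_eq_zero_iff_of_nonneg (hnn ξ) (hint _ (hcont ξ x'))] at hξ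
      apply integral_eq_zero_of_ae
      filter_upwards [hξ] with ω hω
      have : ∏ l : {l : Fin ν // l ≠ i}, (x' l.1) (ω l) = 0 := by
        rcases mul_eq_zero.mp hω with h | h
        · exact absurd h (hKpos _).ne'
        · exact h
      simp [this]
    · right
      intro ξ
      push Not at h
      exact lt_of_le_of_ne (integral_nonneg (hnn ξ)) (h ξ).symm
  have hupd : ∀ x : C(X j, ℝ), (∀ ξ, 0 ≤ x ξ) → ∀ l, ∀ ξ, 0 ≤ Function.update z j x l ξ := by
    intro x hx l
    by_cases h : l = j
    · subst h; simpa using hx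
    · simpa [h] using hz l
  have : Nonempty (X i) := inferInstance
  refine aux_funD _ _ D hD1 (hdich _ (hupd x hx)) (hdich _ (hupd y hy)) ?_
  intro ξ ξ'
  let j' : {l : Fin ν // l ≠ i} := ⟨j, hij.symm⟩
  let e := MeasurableEquiv.piEquivPiSubtypeProd (fun l : {l : Fin ν // l ≠ i} => X l.1)
    (fun l => l = j')
  obtain ⟨α, β, hα, hβ, he⟩ :
      ∃ (α : Measure (∀ l : {l : {l : Fin ν // l ≠ i} // l = j'}, X l.1.1))
        (β : Measure (∀ l : {l : {l : Fin ν // l ≠ i} // ¬ l = j'}, X l.1.1)),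
        SigmaFinite α ∧ SigmaFinite β ∧ MeasurePreserving e μ (α.prod β) :=
    ⟨_, _, inferInstance, inferInstance, measurePreserving_piEquivPiSubtypeProd
      (fun l : {l : Fin ν // l ≠ i} => η l.1) (fun l => l = j')⟩
  let w : (∀ l : {l : Fin ν // l ≠ i}, X l.1) → ℝ := fun ω =>
    ∏ l ∈ Finset.univ.erase j', z l.1 (ω l)
  have hw0 : ∀ ω, 0 ≤ w ω := fun ω => Finset.prod_nonneg fun l _ => hz _ _
  have hwc : Continuous w := by fun_prop
  have hprod : ∀ (x : C(X j, ℝ)) ω,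
      ∏ l : {l : Fin ν // l ≠ i}, (Function.update z j x l.1) (ω l) = w ω * x (ω j') := by
    intro x ω
    rw [← Finset.mul_prod_erase _ _ (Finset.mem_univ j'), mul_comm]
    congr 1
    · refine Finset.prod_congr rfl fun l hl => ?_
      have hl' : l.1 ≠ j := fun h => (Finset.ne_of_mem_erase hl) (Subtype.ext h)
      rw [Function.update_of_ne hl']
    · simp [j']
  let p : X i → (∀ l : {l : Fin ν // l ≠ i}, X l.1) → ℝ := fun ξ ω =>
    K (insertAt X i ξ ω) * w ω
  have hp0 : ∀ ξ ω, 0 ≤ p ξ ω := fun ξ ω => mul_nonneg (hKpos _).le (hw0 ω)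
  have hpc : ∀ ξ, Continuous (p ξ) := fun ξ => by
    have := hins ξ
    fun_prop
  have hpm : ∀ ξ, Measurable (p ξ) := fun ξ => aux_meas _ (hpc ξ)
  -- the integral operator as a lower integral over the split product
  have hrep : ∀ (x : C(X j, ℝ)) (ξ : X i), (∀ s, 0 ≤ x s) →
      ENNReal.ofReal (intOp K η i (Function.update z j x) ξ) =
        ∫⁻ c, ENNReal.ofReal (p ξ (e.symm c)) * ENNReal.ofReal (x (c.1 ⟨j', rfl⟩))
          ∂(α.prod β) := by
    intro x ξ hx
    have h1 : intOp K η i (Function.update z j x) ξ = ∫ ω, p ξ ω * x (ω j') ∂μ := by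
      unfold intOp
      refine integral_congr_ae (Filter.Eventually.of_forall fun ω => ?_)
      simp only [hprod, p]
      ring
    have hcx : Continuous fun ω => p ξ ω * x (ω j') := by
      have := hpc ξ
      fun_prop
    rw [h1, ofReal_integral_eq_lintegral_ofReal (hint _ hcx)
      (Filter.Eventually.of_forall fun ω => mul_nonneg (hp0 ξ ω) (hx _))]
    refine Eq.trans ?_ (he.lintegral_comp_emb e.measurableEmbedding _)
    refine lintegral_congr fun ω => ?_
    rw [ENNReal.ofReal_mul (hp0 ξ ω)]
    congr 2
    exact congrArg (p ξ) (e.symm_apply_apply ω).symm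
  have hmx : ∀ x : C(X j, ℝ), Measurable
      fun s : (∀ l : {l : {l : Fin ν // l ≠ i} // l = j'}, X l.1.1) =>
        ENNReal.ofReal (x (s ⟨j', rfl⟩)) := fun x =>
    (x.continuous.measurable.comp (measurable_pi_apply
      (X := fun l : {l : {l : Fin ν // l ≠ i} // l = j'} => X l.1.1) ⟨j', rfl⟩)).ennreal_ofReal
  have hI0 : ∀ (x : C(X j, ℝ)) (ξ : X i), (∀ s, 0 ≤ x s) →
      0 ≤ intOp K η i (Function.update z j x) ξ := fun x ξ hx =>
    integral_nonneg fun ω => mul_nonneg (hKpos _).le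
      (Finset.prod_nonneg fun l _ => hupd x hx _ _)
  have hD0 : 0 ≤ D := by linarith
  rw [← ENNReal.ofReal_le_ofReal_iff
    (mul_nonneg hD0 (mul_nonneg (hI0 y ξ hy) (hI0 x ξ' hx)))]
  rw [ENNReal.ofReal_mul (hI0 x ξ hx), ENNReal.ofReal_mul hD0, ENNReal.ofReal_mul (hI0 y ξ hy),
    hrep x ξ hx, hrep y ξ' hy, hrep y ξ hy, hrep x ξ' hx]
  refine aux_prod _ _ (fun c => ENNReal.ofReal (p ξ (e.symm c)))
    (fun c => ENNReal.ofReal (p ξ' (e.symm c))) _ _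
    ((hpm ξ).comp e.symm.measurable).ennreal_ofReal
    ((hpm ξ').comp e.symm.measurable).ennreal_ofReal (hmx x) (hmx y) _ ?_
  intro s t r r'
  rw [← ENNReal.ofReal_mul (hp0 _ _), ← ENNReal.ofReal_mul (hp0 _ _), ← ENNReal.ofReal_mul hD0]
  apply ENNReal.ofReal_le_ofReal
  have hes : ∀ s r l, e.symm (s, r) l = if h : l = j' then s ⟨l, h⟩ else r ⟨l, h⟩ :=
    fun s r l => rfl
  have hwe : ∀ s t r, w (e.symm (s, r)) = w (e.symm (t, r)) := by
    intro s t r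
    refine Finset.prod_congr rfl fun l hl => ?_
    have hl' : l ≠ j' := Finset.ne_of_mem_erase hl
    rw [hes, hes, dif_neg hl', dif_neg hl']
  have hue : ∀ (ξ ξ' : X i) s t r r', Function.update (insertAt X i ξ (e.symm (s, r))) j
      (insertAt X i ξ' (e.symm (t, r')) j) = insertAt X i ξ (e.symm (t, r)) := by
    intro ξ ξ' s t r r'
    funext l
    by_cases hl : l = j
    · subst hl
      rw [Function.update_self]
      unfold insertAt
      rw [dif_neg hij.symm, dif_neg hij.symm, hes, hes, dif_pos rfl, dif_pos rfl]
    · rw [Function.update_of_ne hl]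
      unfold insertAt
      by_cases hli : l = i
      · rw [dif_pos hli, dif_pos hli]
      · have hl' : (⟨l, hli⟩ : {l : Fin ν // l ≠ i}) ≠ j' := fun h => hl (congrArg Subtype.val h)
        rw [dif_neg hli, dif_neg hli, hes, hes, dif_neg hl', dif_neg hl']
  have hk := hswap (insertAt X i ξ (e.symm (s, r))) (insertAt X i ξ' (e.symm (t, r')))
  rw [hue, hue] at hk
  simp only [p]
  rw [hwe t s r, hwe t s r']
  have := mul_le_mul_of_nonneg_right hk (mul_nonneg (hw0 (e.symm (s, r))) (hw0 (e.symm (s, r'))))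
  calc _ = _ := by ring
    _ ≤ _ := this
    _ = _ := by ring
end
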